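/- arXiv:2506.21717 — 3 statements merged into one kernel-verified Lean document; each statement's English description precedes it below -/
import Mathlib

section
/- Let (K, v) be a henselian valued field with residue characteristic different from 2 and φ a nondegenerate quadratic form over K such that v(G(φ)) ⊄ 2·v(K×). Then G(φ) = H(φ) = Hyp₂(φ). -/
open scoped TensorProduct

/-- A (finite-dimensional) quadratic form over the field `K`, bundled with its
underlying vector space. -/
structure QF (K : Type) [Field K] where
  V : Type
  [iAG : AddCommGroup V]
  [iM : Module K V]
  [iFD : FiniteDimensional K V]
  q : QuadraticForm K V

namespace QF

variable {K : Type} [Field K]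

instance (φ : QF K) : AddCommGroup φ.V := φ.iAG
instance (φ : QF K) : Module K φ.V := φ.iM
instance (φ : QF K) : FiniteDimensional K φ.V := φ.iFD

/-- dimension of a quadratic form -/
noncomputable def dim (φ : QF K) : ℕ := Module.finrank K φ.V

/-- isometry of quadratic forms -/
def Equiv (φ ψ : QF K) : Prop := QuadraticMap.Equivalent φ.q ψ.q

/-- nondegeneracy of a quadratic form (via its polar bilinear form) -/
def Nondeg (φ : QF K) : Prop := (QuadraticMap.polarBilin φ.q).Nondegenerate

/-- scaling a quadratic form by a scalar -/
def smul (a : K) (φ : QF K) : QF K := { V := φ.V, q := a • φ.q }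

/-- orthogonal sum of quadratic forms -/
def add (φ ψ : QF K) : QF K := { V := φ.V × ψ.V, q := φ.q.prod ψ.q }

/-- the zero-dimensional quadratic form -/
noncomputable def zero : QF K := { V := Fin 0 → K, q := QuadraticMap.weightedSumSquares K (fun i : Fin 0 => (1 : K)) }

/-- the form `⟨1⟩` -/
noncomputable def one : QF K := { V := Fin 1 → K, q := QuadraticMap.weightedSumSquares K (fun _ : Fin 1 => (1 : K)) }

/-- the binary form `⟨1, -a⟩ = ⟪a⟫` -/
noncomputable def bin (a : K) : QF K :=
  { V := Fin 2 → K, q := QuadraticMap.weightedSumSquares K ![(1 : K), -a] }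

/-- tensor product of quadratic forms -/
noncomputable def tmul [Invertible (2 : K)] (φ ψ : QF K) : QF K :=
  { V := φ.V ⊗[K] ψ.V, q := QuadraticForm.tmul φ.q ψ.q }

/-- `m` copies of the hyperbolic plane `⟨1, -1⟩` -/
noncomputable def hyperbolics : ℕ → QF K
  | 0 => zero
  | m + 1 => add (bin 1) (hyperbolics m)

/-- a form is hyperbolic if it is isometric to a sum of hyperbolic planes -/
def IsHyperbolic (φ : QF K) : Prop := ∃ m : ℕ, φ.Equiv (hyperbolics m)

/-- anisotropy -/
def Anisotropic (φ : QF K) : Prop := φ.q.Anisotropic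

/-- the Witt index -/
noncomputable def wittIndex (φ : QF K) : ℕ :=
  sSup {m : ℕ | ∃ ψ : QF K, φ.Equiv (add (hyperbolics m) ψ)}

/-- a form is split if its anisotropic part has dimension at most one -/
def IsSplit (φ : QF K) : Prop :=
  ∃ (m : ℕ) (ψ : QF K), ψ.Anisotropic ∧ ψ.dim ≤ 1 ∧ φ.Equiv (add (hyperbolics m) ψ)

/-- `n`-fold orthogonal sum of a fixed form -/
noncomputable def nsmul : ℕ → QF K → QF K
  | 0, _ => zero
  | n + 1, φ => add φ (nsmul n φ)

/-- orthogonal sum of a list of forms -/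
noncomputable def sumList : List (QF K) → QF K
  | [] => zero
  | φ :: l => add φ (sumList l)

/-- the Pfister form `⟨⟨a₁, …, aₙ⟩⟩` -/
noncomputable def pfister [Invertible (2 : K)] : List K → QF K
  | [] => one
  | a :: l => tmul (bin a) (pfister l)

/-- Witt equivalence of quadratic forms -/
def WittEquiv (φ ψ : QF K) : Prop := IsHyperbolic (add φ (smul (-1) ψ))

/-- membership in the `n`-th power of the fundamental ideal: Witt equivalence
to an orthogonal sum of scaled `n`-fold Pfister forms -/
def InFundPow [Invertible (2 : K)] (n : ℕ) (φ : QF K) : Prop :=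
  ∃ (r : ℕ) (c : Fin r → K) (l : Fin r → (Fin n → K)),
    (∀ i, c i ≠ 0) ∧
    WittEquiv φ (sumList ((List.finRange r).map fun i => smul (c i) (pfister (List.ofFn (l i)))))

/-- the group of similarity factors `G(φ) = {a ∈ K× : aφ ≅ φ}`, as a set -/
def G (φ : QF K) : Set K := {a | a ≠ 0 ∧ (smul a φ).Equiv φ}

/-- similarity factors of a family of forms -/
def GT {r : ℕ} (φ : Fin r → QF K) : Set K := ⋂ i, G (φ i)

end QF

/-- a bundled field extension of `K` -/
structure FieldExt (K : Type) [Field K] where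
  carrier : Type
  [iF : Field carrier]
  [iA : Algebra K carrier]

attribute [instance] FieldExt.iF FieldExt.iA

namespace QF

variable {K : Type} [Field K]

/-- base change of a quadratic form along a field extension -/
noncomputable def baseChange [Invertible (2 : K)] (L : Type) [Field L] [Algebra K L]
    (φ : QF K) : QF L :=
  { V := L ⊗[K] φ.V, q := QuadraticForm.baseChange L φ.q }

end QF

/-- the set of nonzero norms of a finite field extension -/
def normSet (K : Type) [Field K] (L : Type) [Field L] [Algebra K L] : Set K :=
  {a | ∃ x : L, x ≠ 0 ∧ Algebra.norm K x = a}

/-- a finite `2`-extension: a tower of quadratic extensions -/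
def IsTwoExtension (K : Type) [Field K] (L : Type) [Field L] [Algebra K L] : Prop :=
  FiniteDimensional K L ∧
    ∃ (n : ℕ) (F : Fin (n + 1) → IntermediateField K L),
      F 0 = ⊥ ∧ F (Fin.last n) = ⊤ ∧
        ∀ i : Fin n, F i.castSucc ≤ F i.succ ∧
          IntermediateField.relfinrank (F i.castSucc) (F i.succ) = 2

/-- a multiquadratic extension: Galois with elementary abelian 2-group -/
def IsMultiquadratic (K : Type) [Field K] (L : Type) [Field L] [Algebra K L] : Prop :=
  FiniteDimensional K L ∧ IsGalois K L ∧ ∀ σ : L ≃ₐ[K] L, σ * σ = 1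

namespace QF

variable {K : Type} [Field K] [Invertible (2 : K)]

/-- generating set for `Hyp(φ)`: norms from finite extensions splitting `φ` -/
def hypSet (φ : QF K) : Set K :=
  {a | ∃ L : FieldExt K, FiniteDimensional K L.carrier ∧
    IsHyperbolic (baseChange L.carrier φ) ∧ a ∈ normSet K L.carrier}

/-- the subgroup `Hyp(φ)` generated by norms of finite extensions splitting `φ` -/
def Hyp (φ : QF K) : Submonoid K := Submonoid.closure (hypSet φ)

/-- generating set for `Hyp₂(φ)`: norms from finite 2-extensions splitting `φ` -/
def hypSet2 (φ : QF K) : Set K :=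
  {a | ∃ L : FieldExt K, IsTwoExtension K L.carrier ∧
    IsHyperbolic (baseChange L.carrier φ) ∧ a ∈ normSet K L.carrier}

/-- the subgroup `Hyp₂(φ)` -/
def Hyp2 (φ : QF K) : Submonoid K := Submonoid.closure (hypSet2 φ)

/-- `H(φ) = K×² · Hyp(φ)` -/
def Hgrp (φ : QF K) : Set K :=
  {x | ∃ s : K, s ≠ 0 ∧ ∃ h ∈ Hyp φ, x = s ^ 2 * h}

/-- `K×² · Hyp₂(φ)` -/
def H2grp (φ : QF K) : Set K :=
  {x | ∃ s : K, s ≠ 0 ∧ ∃ h ∈ Hyp2 φ, x = s ^ 2 * h}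

/-- the splitting pattern: the set of Witt indices over all field extensions -/
def Sp (φ : QF K) : Set ℕ :=
  {m | ∃ L : FieldExt K, m = wittIndex (baseChange L.carrier φ)}

end QF

namespace QF

variable {K : Type} [Field K] [Invertible (2 : K)]

/-- norms from finite extensions splitting all forms in a family -/
def hypSetT {r : ℕ} (φ : Fin r → QF K) : Set K :=
  {a | ∃ L : FieldExt K, FiniteDimensional K L.carrier ∧
    (∀ i, IsHyperbolic (baseChange L.carrier (φ i))) ∧ a ∈ normSet K L.carrier}

/-- the subgroup `Hyp` of a family of forms -/
def HypT {r : ℕ} (φ : Fin r → QF K) : Submonoid K := Submonoid.closure (hypSetT φ)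

/-- norms from finite 2-extensions splitting all forms in a family -/
def hypSet2T {r : ℕ} (φ : Fin r → QF K) : Set K :=
  {a | ∃ L : FieldExt K, IsTwoExtension K L.carrier ∧
    (∀ i, IsHyperbolic (baseChange L.carrier (φ i))) ∧ a ∈ normSet K L.carrier}

/-- the subgroup `Hyp₂` of a family of forms -/
def Hyp2T {r : ℕ} (φ : Fin r → QF K) : Submonoid K := Submonoid.closure (hypSet2T φ)

/-- `H` of a family of forms: `K×² · Hyp` -/
def HgrpT {r : ℕ} (φ : Fin r → QF K) : Set K :=
  {x | ∃ s : K, s ≠ 0 ∧ ∃ h ∈ HypT φ, x = s ^ 2 * h}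

end QF

/-- the map `O → O'` between valuation rings induced by a compatible field embedding -/
def liftVSHom {K M : Type} [Field K] [Field M] [Algebra K M]
    (O : ValuationSubring K) (OM : ValuationSubring M)
    (hc : ∀ x : K, x ∈ O ↔ algebraMap K M x ∈ OM) : O →+* OM where
  toFun x := ⟨algebraMap K M x, (hc x).1 x.2⟩
  map_one' := by ext; simp
  map_mul' x y := by ext; simp
  map_zero' := by ext; simp
  map_add' x y := by ext; simp

/-- `v` is unramified in the subextension `E` of `M/K`: the value group does not grow
and the residue field extension is separable (every residue is a simple root of a
separable polynomial over the residue field of `O`) -/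
def UnramifiedIn {K M : Type} [Field K] [Field M] [Algebra K M]
    (O : ValuationSubring K) (OM : ValuationSubring M)
    (hc : ∀ x : K, x ∈ O ↔ algebraMap K M x ∈ OM) (E : IntermediateField K M) : Prop :=
  (∀ y : M, y ∈ E → y ≠ 0 →
      ∃ x : K, x ≠ 0 ∧ OM.valuation y = OM.valuation (algebraMap K M x)) ∧
  (∀ y : M, y ∈ E → ∀ hy : y ∈ OM, ∃ p : Polynomial O, p.Monic ∧
      (p.map (IsLocalRing.residue O)).Separable ∧
      Polynomial.eval (⟨y, hy⟩ : OM) (p.map (liftVSHom O OM hc)) ∈ IsLocalRing.maximalIdeal OM)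

/-- the value group of a valuation, as a subgroup of the units of the codomain -/
def unitsValueGroup {L Γ : Type} [Field L] [LinearOrderedCommGroupWithZero Γ]
    (w : Valuation L Γ) : Subgroup Γˣ :=
  (Units.map w.toMonoidWithZeroHom.toMonoidHom).range

/-- iterated Laurent series field, bundled with its field structure -/
noncomputable def IterLaurentP (k : Type) [Field k] : ℕ → Σ' (T : Type), Field T :=
  fun n => Nat.rec ⟨k, ‹Field k›⟩
    (fun _ p => by letI := p.2; exact ⟨LaurentSeries p.1, inferInstance⟩) n

/-- iterated Laurent series field `k((t₁))…((tₙ))` -/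
@[reducible] noncomputable def IterLaurent (k : Type) [Field k] (n : ℕ) : Type :=
  (IterLaurentP k n).1

noncomputable instance (k : Type) [Field k] (n : ℕ) : Field (IterLaurent k n) :=
  (IterLaurentP k n).2

/-- the embedding of the coefficient field in the iterated Laurent series field -/
noncomputable def iterC (k : Type) [Field k] : ∀ n, k →+* IterLaurent k n
  | 0 => RingHom.id k
  | n + 1 => (HahnSeries.C : IterLaurent k n →+* LaurentSeries (IterLaurent k n)).comp (iterC k n)

/-- the variables `t₁, …, tₙ` of the iterated Laurent series field -/
noncomputable def tvar (k : Type) [Field k] : ∀ n, Fin n → IterLaurent k n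
  | 0 => fun i => i.elim0
  | n + 1 => fun i =>
      (Fin.lastCases (motive := fun _ => LaurentSeries (IterLaurent k n))
        (HahnSeries.single 1 1) (fun j => HahnSeries.C (tvar k n j)) i : IterLaurent k (n + 1))


namespace SM
open QuadraticMap

/-- nondegeneracy in elementary form -/
def ND {K V : Type} [Field K] [AddCommGroup V] [Module K V] (q : QuadraticForm K V) : Prop :=
  ∀ x, (∀ y, polar q x y = 0) → x = 0

theorem nd_iff {K V : Type} [Field K] [AddCommGroup V] [Module K V] (q : QuadraticForm K V) :
    (polarBilin q).Nondegenerate ↔ ND q := by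
  constructor
  · intro h x hx
    exact h.1 x (fun y => by simpa using hx y)
  · intro h
    refine ⟨fun x hx => h x (fun y => by simpa using hx y), fun x hx => h x (fun y => ?_)⟩
    rw [polar_comm]; simpa using hx y

theorem two_ne {K : Type} [Field K] [Invertible (2 : K)] : (2 : K) ≠ 0 := Invertible.ne_zero 2

theorem q_add {K V : Type} [Field K] [AddCommGroup V] [Module K V] (q : QuadraticForm K V)
    (x y : V) : q (x + y) = q x + q y + polar q x y := by
  simp [polar]

theorem nd_of_equivalent {K V W : Type} [Field K] [AddCommGroup V] [Module K V]
    [AddCommGroup W] [Module K W] {q : QuadraticForm K V} {r : QuadraticForm K W}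
    (h : q.Equivalent r) (hq : ND q) : ND r := by
  obtain ⟨e⟩ := h
  intro x hx
  have : e.symm x = 0 := by
    apply hq
    intro y
    have h1 := hx (e y)
    have h2 : polar q (e.symm x) y = polar r x (e y) := by
      have h3 : ∀ z, q z = r (e z) := fun z => (e.map_app z).symm
      unfold polar
      rw [h3, h3, h3, map_add]
      simp
    rw [h2, h1]
  have h2 : e (e.symm x) = x := e.apply_symm_apply x
  rw [← h2, this]; simp

theorem nd_prod {K V W : Type} [Field K] [AddCommGroup V] [Module K V]
    [AddCommGroup W] [Module K W] {q : QuadraticForm K V} {r : QuadraticForm K W} :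
    ND (q.prod r) ↔ ND q ∧ ND r := by
  constructor
  · intro h
    constructor
    · intro x hx
      have := h (x, 0) (fun y => by simp [hx])
      simpa using this
    · intro x hx
      have := h (0, x) (fun y => by simp [hx])
      simpa using this
  · rintro ⟨h1, h2⟩ ⟨x, y⟩ hx
    have hx1 : x = 0 := h1 x (fun z => by simpa using hx (z, 0))
    have hy1 : y = 0 := h2 y (fun z => by simpa using hx (0, z))
    simp [hx1, hy1]

theorem nd_smul {K V : Type} [Field K] [AddCommGroup V] [Module K V]
    {q : QuadraticForm K V} {a : K} (ha : a ≠ 0) (hq : ND q) : ND (a • q) := by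
  intro x hx
  apply hq
  intro y
  have := hx y
  rw [FunLike.coe_smul, polar_smul] at this
  simpa [ha] using this

theorem split {K V A : Type} [Field K] [AddCommGroup V] [Module K V] [AddCommGroup A] [Module K A]
    [FiniteDimensional K A] (q : QuadraticForm K V) (qA : QuadraticForm K A)
    (i : A →ₗ[K] V) (hi : ∀ a, q (i a) = qA a) (hA : ND qA) :
    ∃ P : Submodule K V, (∀ v, v ∈ P ↔ ∀ a, polar q (i a) v = 0) ∧
      Nonempty ((qA.prod (q.comp P.subtype)).IsometryEquiv q) := by
  have hpol : ∀ a b, polar q (i a) (i b) = polar qA a b := by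
    intro a b
    unfold polar
    rw [← map_add, hi, hi, hi]
  let P : Submodule K V :=
    { carrier := {v | ∀ a, polar q (i a) v = 0}
      zero_mem' := by intro a; simp
      add_mem' := by
        intro x y hx hy a
        rw [polar_add_right, hx a, hy a, add_zero]
      smul_mem' := by
        intro c x hx a
        rw [polar_smul_right, hx a, smul_zero] }
  have hP : ∀ v, v ∈ P ↔ ∀ a, polar q (i a) v = 0 := fun v => Iff.rfl
  refine ⟨P, hP, ?_⟩
  let f : (A × P) →ₗ[K] V := LinearMap.coprod i P.subtype
  have hf : ∀ x, f x = i x.1 + x.2 := fun x => by simp [f]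
  have hinj : Function.Injective f := by
    rw [← LinearMap.ker_eq_bot, LinearMap.ker_eq_bot']
    rintro ⟨a, p⟩ h
    rw [hf] at h
    have ha : a = 0 := by
      apply hA
      intro b
      have h1 : polar q (i b) (i a + p) = 0 := by rw [h]; simp
      rw [polar_add_right, (hP p).1 p.2 b, add_zero, hpol, polar_comm] at h1
      exact h1
    subst ha
    simp at h
    simp [h]
  have hsurj : Function.Surjective f := by
    intro v
    have hbinj : Function.Injective (polarBilin qA) := by
      rw [← LinearMap.ker_eq_bot, LinearMap.ker_eq_bot']
      intro x hx
      apply hA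
      intro y
      simpa using LinearMap.congr_fun hx y
    have hbs : Function.Surjective (polarBilin qA : A →ₗ[K] Module.Dual K A) :=
      (LinearMap.injective_iff_surjective_of_finrank_eq_finrank
        (Subspace.dual_finrank_eq).symm).1 hbinj
    obtain ⟨a, ha⟩ := hbs ((polarBilin q v).comp i)
    have hm : v - i a ∈ P := by
      rw [hP]
      intro b
      have h1 := LinearMap.congr_fun ha b
      simp at h1
      rw [polar_sub_right, polar_comm q (i b) v, ← h1, hpol, polar_comm, sub_self]
    exact ⟨(a, ⟨v - i a, hm⟩), by rw [hf]; simp⟩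
  refine ⟨⟨LinearEquiv.ofBijective f ⟨hinj, hsurj⟩, ?_⟩⟩
  rintro ⟨a, p⟩
  change q (f (a, p)) = _
  rw [hf, q_add, (hP p).1 p.2 a, hi]
  simp

/-- transitivity of the isometry group on vectors of equal nonzero length -/
theorem exists_isometry {K V : Type} [Field K] [Invertible (2 : K)] [AddCommGroup V] [Module K V]
    (q : QuadraticForm K V) (x y : V) (hxy : q x = q y) (hx : q x ≠ 0) :
    ∃ e : q.IsometryEquiv q, e x = y := by
  -- reflections
  have hrefl : ∀ u, q u ≠ 0 → ∃ e : q.IsometryEquiv q, ∀ z, e z = z - (polar q u z / q u) • u := by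
    intro u hu
    let f : V →ₗ[K] V := LinearMap.id - (LinearMap.toSpanSingleton K V ((q u)⁻¹ • u)).comp (polarBilin q u)
    have hf : ∀ z, f z = z - (polar q u z / q u) • u := by
      intro z
      simp [f, smul_smul, div_eq_mul_inv]
    have hpu : ∀ z, polar q u (f z) = - polar q u z := by
      intro z
      rw [hf, polar_sub_right, polar_smul_right, polar_self]
      simp only [smul_eq_mul, nsmul_eq_mul, Nat.cast_ofNat]
      field_simp
      ring
    have hff : ∀ z, f (f z) = z := by
      intro z
      rw [hf (f z), hpu, hf]
      module
    let e : V ≃ₗ[K] V := LinearEquiv.ofInvolutive f hff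
    refine ⟨⟨e, ?_⟩, fun z => hf z⟩
    intro z
    change q (f z) = q z
    rw [hf, sub_eq_add_neg, ← neg_smul, q_add, QuadraticMap.map_smul, polar_smul_right, polar_comm]
    simp only [smul_eq_mul]
    field_simp
    ring
  by_cases h : q (x - y) = 0
  · have hs : q (x + y) ≠ 0 := by
      intro h2
      have h3 : q (x + y) + q (x - y) = 2 * q x + 2 * q y := by
        rw [sub_eq_add_neg, q_add, q_add, polar_neg_right, QuadraticMap.map_neg]; ring
      rw [h, h2, ← hxy] at h3
      have : (2 * 2) * q x = 0 := by linear_combination -h3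
      have h22 := two_ne (K := K)
      simp [h22, hx] at this
    obtain ⟨e, he⟩ := hrefl _ hs
    have hp : polar q (x + y) x = q (x + y) := by
      rw [polar_add_left, polar_self, q_add, ← hxy, polar_comm q y x]
      simp only [nsmul_eq_mul, Nat.cast_ofNat]; ring
    have hex : e x = -y := by
      rw [he, hp, div_self hs]; module
    refine ⟨e.trans ⟨LinearEquiv.neg K, fun z => ?_⟩, ?_⟩
    · simp
    · change - (e x) = y
      rw [hex]; simp
  · obtain ⟨e, he⟩ := hrefl _ h
    have hp : polar q (x - y) x = q (x - y) := by
      rw [polar_sub_left, polar_self, sub_eq_add_neg x y, q_add, QuadraticMap.map_neg, ← hxy, polar_comm q y x,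
        polar_neg_right]
      simp only [nsmul_eq_mul, Nat.cast_ofNat]; ring
    exact ⟨e, by rw [he, hp, div_self h]; module⟩

/-- one-dimensional form -/
noncomputable def line {K : Type} [Field K] (a : K) : QuadraticForm K K := a • QuadraticMap.sq

theorem line_apply {K : Type} [Field K] (a x : K) : line a x = a * (x * x) := by
  simp [line]

theorem line_polar {K : Type} [Field K] (a x y : K) : polar (line a) x y = 2 * a * (x * y) := by
  simp [polar, line_apply]; ring

theorem nd_line {K : Type} [Field K] [Invertible (2 : K)] {a : K} (ha : a ≠ 0) : ND (line a) := by
  intro x hx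
  have := hx 1
  rw [line_polar] at this
  simpa [ha, two_ne (K := K)] using this

theorem cancel_line {K V W : Type} [Field K] [Invertible (2 : K)] [AddCommGroup V] [Module K V]
    [AddCommGroup W] [Module K W] {q : QuadraticForm K V} {r : QuadraticForm K W} {a : K}
    (ha : a ≠ 0) (h : ((line a).prod q).Equivalent ((line a).prod r)) : q.Equivalent r := by
  obtain ⟨e⟩ := h
  obtain ⟨g, hg⟩ := exists_isometry ((line a).prod r) (e (1, 0)) (1, 0)
    (by rw [e.map_app]; simp [line_apply]) (by rw [e.map_app]; simp [line_apply, ha])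
  let E := e.trans g
  have hE : E (1, 0) = (1, 0) := hg
  have hE' : E.symm (1, 0) = (1, 0) := by
    rw [← hE]; exact E.symm_apply_apply _
  have key : ∀ {X Y : Type} [AddCommGroup X] [Module K X] [AddCommGroup Y] [Module K Y]
      {s : QuadraticForm K X} {t : QuadraticForm K Y}
      (F : ((line a).prod s).IsometryEquiv ((line a).prod t)), F (1, 0) = (1, 0) →
      ∀ v, (F (0, v)).1 = 0 := by
    intro X Y _ _ _ _ s t F hF v
    have h1 : polar ((line a).prod t) (F (1, 0)) (F (0, v)) = 0 := by
      have : polar ((line a).prod t) (F (1, 0)) (F (0, v))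
          = polar ((line a).prod s) (1, 0) (0, v) := by
        unfold polar
        rw [← map_add, F.map_app, F.map_app, F.map_app]
      rw [this]; simp [line_polar]
    rw [hF] at h1
    simpa [line_polar, ha, two_ne (K := K)] using h1
  have k1 := key E hE
  have k2 := key E.symm hE'
  let f : V →ₗ[K] W := (LinearMap.snd K K W).comp (E.toLinearEquiv.toLinearMap.comp (LinearMap.inr K K V))
  let f' : W →ₗ[K] V := (LinearMap.snd K K V).comp (E.symm.toLinearEquiv.toLinearMap.comp (LinearMap.inr K K W))
  have hf : ∀ v, E (0, v) = (0, f v) := fun v => Prod.ext (k1 v) rfl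
  have hf' : ∀ v, E.symm (0, v) = (0, f' v) := fun v => Prod.ext (k2 v) rfl
  have h1 : ∀ v, f' (f v) = v := by
    intro v
    have : E.symm (E (0, v)) = (0, v) := E.symm_apply_apply _
    rw [hf, hf'] at this
    exact congrArg Prod.snd this
  have h2 : ∀ v, f (f' v) = v := by
    intro v
    have : E (E.symm (0, v)) = (0, v) := E.apply_symm_apply _
    rw [hf', hf] at this
    exact congrArg Prod.snd this
  refine ⟨⟨LinearEquiv.ofLinearMap f f' (LinearMap.ext h2) (LinearMap.ext h1), fun v => ?_⟩⟩
  change r (f v) = q v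
  have := E.map_app (0, v)
  rw [hf] at this
  simpa [line_apply] using this

noncomputable def prodAssoc' {K A B C : Type} [Field K] [AddCommGroup A] [Module K A]
    [AddCommGroup B] [Module K B] [AddCommGroup C] [Module K C] (a : QuadraticForm K A)
    (b : QuadraticForm K B) (c : QuadraticForm K C) :
    ((a.prod b).prod c).IsometryEquiv (a.prod (b.prod c)) :=
  ⟨LinearEquiv.prodAssoc K A B C, fun x => by simp [add_assoc]⟩

theorem finrank_eq_of_equivalent {K V W : Type} [Field K] [AddCommGroup V] [Module K V]
    [AddCommGroup W] [Module K W] {q : QuadraticForm K V} {r : QuadraticForm K W}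
    (h : q.Equivalent r) : Module.finrank K V = Module.finrank K W := by
  obtain ⟨e⟩ := h
  exact e.toLinearEquiv.finrank_eq

theorem exists_ne_zero {K V : Type} [Field K] [AddCommGroup V] [Module K V]
    [FiniteDimensional K V] {q : QuadraticForm K V} (hq : ND q) (hpos : 0 < Module.finrank K V) :
    ∃ u, q u ≠ 0 := by
  by_contra! h
  have : Nontrivial V := Module.finrank_pos_iff.1 hpos
  obtain ⟨x, hx⟩ := exists_ne (0 : V)
  exact hx (hq x (fun y => by simp [polar, h]))

/-- Witt cancellation -/
theorem witt_cancel {K : Type} [Field K] [Invertible (2 : K)] : ∀ (n : ℕ) {A V W : Type}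
    [AddCommGroup A] [Module K A] [FiniteDimensional K A]
    [AddCommGroup V] [Module K V]
    [AddCommGroup W] [Module K W] {a : QuadraticForm K A} {q : QuadraticForm K V}
    {r : QuadraticForm K W}, Module.finrank K A = n → ND a →
    (a.prod q).Equivalent (a.prod r) → q.Equivalent r := by
  intro n
  induction n with
  | zero =>
    intro A V W _ _ _ _ _ _ _ a q r hn ha h
    have hs : Subsingleton A := Module.finrank_zero_iff.1 hn
    have key : ∀ {X : Type} [AddCommGroup X] [Module K X] (s : QuadraticForm K X),
        (a.prod s).Equivalent s := by
      intro X _ _ s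
      refine ⟨⟨LinearEquiv.ofBijective (LinearMap.snd K A X) ⟨?_, ?_⟩, ?_⟩⟩
      · rintro ⟨x, y⟩ ⟨x', y'⟩ h
        exact Prod.ext (Subsingleton.elim _ _) h
      · intro y; exact ⟨(0, y), rfl⟩
      · rintro ⟨x, y⟩
        have : x = 0 := Subsingleton.elim _ _
        subst this
        change s y = _
        simp
    exact ((key q).symm.trans h).trans (key r)
  | succ n ih =>
    intro A V W _ _ _ _ _ _ _ a q r hn ha h
    obtain ⟨u, hu⟩ := exists_ne_zero ha (by omega)
    obtain ⟨P, hP, ⟨e⟩⟩ := split a (line (a u)) (LinearMap.toSpanSingleton K A u)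
      (fun x => by simp [line_apply, QuadraticMap.map_smul, mul_comm]) (nd_line hu)
    have hnd := (nd_prod.1 (nd_of_equivalent ⟨e.symm⟩ ha)).2
    have hfr : Module.finrank K P = n := by
      have := e.toLinearEquiv.finrank_eq
      rw [Module.finrank_prod, Module.finrank_self] at this
      omega
    apply ih hfr hnd
    apply cancel_line hu
    have key : ∀ {X : Type} [AddCommGroup X] [Module K X] (s : QuadraticForm K X),
        ((line (a u)).prod ((a.comp P.subtype).prod s)).Equivalent (a.prod s) := by
      intro X _ _ s
      exact Equivalent.trans ⟨(prodAssoc' _ _ _).symm⟩ (Equivalent.prod ⟨e⟩ (Equivalent.refl s))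
    exact ((key q).trans h).trans (key r).symm

end SM

namespace SM
open QuadraticMap

/-- existence of a totally isotropic subspace of at least half the dimension -/
def Lag {K V : Type} [Field K] [AddCommGroup V] [Module K V] (q : QuadraticForm K V) : Prop :=
  ∃ W : Submodule K V, (∀ w ∈ W, q w = 0) ∧ Module.finrank K V ≤ 2 * Module.finrank K W

theorem Lag.equivalent {K V V' : Type} [Field K] [AddCommGroup V] [Module K V]
    [AddCommGroup V'] [Module K V'] {q : QuadraticForm K V} {r : QuadraticForm K V'}
    (h : q.Equivalent r) (hq : Lag q) : Lag r := by
  obtain ⟨W, hW, hd⟩ := hq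
  have hfr := finrank_eq_of_equivalent h
  obtain ⟨e⟩ := h
  refine ⟨W.map e.toLinearEquiv.toLinearMap, ?_, ?_⟩
  · rintro _ ⟨w, hw, rfl⟩
    exact (e.map_app w).trans (hW w hw)
  · rw [← hfr, LinearEquiv.finrank_map_eq]; exact hd

theorem Lag.prod {K V V' : Type} [Field K] [AddCommGroup V] [Module K V] [FiniteDimensional K V]
    [AddCommGroup V'] [Module K V'] [FiniteDimensional K V']
    {q : QuadraticForm K V} {r : QuadraticForm K V'}
    (hq : Lag q) (hr : Lag r) : Lag (q.prod r) := by
  obtain ⟨W, hW, hd⟩ := hq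
  obtain ⟨W', hW', hd'⟩ := hr
  refine ⟨W.prod W', ?_, ?_⟩
  · rintro ⟨x, y⟩ ⟨hx, hy⟩
    simp [hW x hx, hW' y hy]
  · let f : (W × W') →ₗ[K] (W.prod W') :=
      (W.subtype.prodMap W'.subtype).codRestrict (W.prod W') (fun x => ⟨x.1.2, x.2.2⟩)
    have hf : Function.Injective f := by
      rintro ⟨x, y⟩ ⟨x', y'⟩ h
      have h1 := congrArg Subtype.val h
      have h2 := congrArg Prod.fst h1
      have h3 := congrArg Prod.snd h1
      exact Prod.ext (Subtype.ext h2) (Subtype.ext h3)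
    have h1 := LinearMap.finrank_le_finrank_of_injective hf
    rw [Module.finrank_prod] at h1 ⊢
    omega

/-- the binary form on its concrete space -/
noncomputable def binQ {K : Type} [Field K] (c : K) : QuadraticForm K (Fin 2 → K) :=
  QuadraticMap.weightedSumSquares K ![(1 : K), -c]

theorem bin_apply {K : Type} [Field K] (c : K) (x : Fin 2 → K) :
    binQ c x = x 0 * x 0 - c * (x 1 * x 1) := by
  change QuadraticMap.weightedSumSquares K ![(1 : K), -c] x = _
  rw [weightedSumSquares_apply]
  simp [Fin.sum_univ_two, sub_eq_add_neg]

theorem bin_polar {K : Type} [Field K] (c : K) (x y : Fin 2 → K) :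
    polar (binQ c) x y = 2 * (x 0 * y 0 - c * (x 1 * y 1)) := by
  unfold polar
  simp only [bin_apply]
  have h0 : ∀ i, (x + y) i = x i + y i := fun i => rfl
  rw [h0, h0]; ring

theorem nd_bin {K : Type} [Field K] [Invertible (2 : K)] {c : K} (hc : c ≠ 0) :
    ND (binQ c) := by
  intro x hx
  have h0 := hx ![1, 0]
  have h1 := hx ![0, 1]
  rw [bin_polar] at h0 h1
  simp [two_ne (K := K), hc] at h0 h1
  funext i
  fin_cases i <;> simp [h0, h1]

theorem lag_bin {K : Type} [Field K] :
    Lag (binQ (1 : K)) := by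
  refine ⟨Submodule.span K {![1, 1]}, ?_, ?_⟩
  · intro w hw
    obtain ⟨a, rfl⟩ := Submodule.mem_span_singleton.1 hw
    rw [bin_apply]; simp
  · rw [finrank_span_singleton]
    · simp
    · intro h
      simpa using congrFun h 0

theorem nd_hyperbolics {K : Type} [Field K] [Invertible (2 : K)] (m : ℕ) :
    ND (QF.hyperbolics (K := K) m).q := by
  induction m with
  | zero =>
    intro x _
    have : Subsingleton (Fin 0 → K) := inferInstance
    exact this.elim x 0
  | succ m ih => exact (nd_prod (q := binQ 1)).2 ⟨nd_bin one_ne_zero, ih⟩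

theorem lag_hyperbolics {K : Type} [Field K] (m : ℕ) :
    Lag (QF.hyperbolics (K := K) m).q := by
  induction m with
  | zero =>
    refine ⟨⊥, by simp, ?_⟩
    have : Module.finrank K (Fin 0 → K) = 0 := by simp
    exact this.le.trans (Nat.zero_le _)
  | succ m ih => exact Lag.prod (q := binQ 1) lag_bin ih

/-- an isotropic vector of a nondegenerate form lies in a hyperbolic plane -/
theorem exists_plane {K V : Type} [Field K] [Invertible (2 : K)] [AddCommGroup V] [Module K V]
    {q : QuadraticForm K V} (hq : ND q) {w : V} (hw : w ≠ 0) (hqw : q w = 0) :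
    ∃ (w' : V) (i : (Fin 2 → K) →ₗ[K] V),
      (∀ a, i a = (a 0 + a 1) • w + (a 0 - a 1) • w') ∧ ∀ a, q (i a) = binQ 1 a := by
  have : ∃ y, polar q w y ≠ 0 := by
    by_contra! h
    exact hw (hq w h)
  obtain ⟨y, hy⟩ := this
  set b := polar q w y with hb
  let w' : V := b⁻¹ • (y - (q y / b) • w)
  have h1 : polar q w w' = 1 := by
    simp only [w']
    rw [polar_smul_right, polar_sub_right, polar_smul_right, polar_self, hqw, ← hb]
    simp [hy]
  have h2 : q w' = 0 := by
    simp only [w']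
    rw [QuadraticMap.map_smul, sub_eq_add_neg, ← neg_smul, q_add, QuadraticMap.map_smul, hqw,
      polar_smul_right, polar_comm, ← hb]
    simp only [smul_eq_mul]
    field_simp
    ring
  let i : (Fin 2 → K) →ₗ[K] V :=
    { toFun := fun a => (a 0 + a 1) • w + (a 0 - a 1) • w'
      map_add' := by intro a b; simp only [Pi.add_apply]; module
      map_smul' := by intro c a; simp only [Pi.smul_apply, smul_eq_mul, RingHom.id_apply]; module }
  refine ⟨w', i, fun a => rfl, fun a => ?_⟩
  change q ((a 0 + a 1) • w + (a 0 - a 1) • w') = _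
  rw [bin_apply]
  rw [q_add, QuadraticMap.map_smul, QuadraticMap.map_smul, polar_smul_left, polar_smul_right, h1, h2, hqw]
  simp only [smul_eq_mul]
  ring

theorem hyperbolic_of_lag {K : Type} [Field K] [Invertible (2 : K)] : ∀ (n : ℕ) {V : Type}
    [AddCommGroup V] [Module K V] [FiniteDimensional K V] {q : QuadraticForm K V},
    Module.finrank K V = n → ND q → Lag q →
    ∃ m, n = 2 * m ∧ q.Equivalent (QF.hyperbolics (K := K) m).q := by
  intro n
  induction n using Nat.strong_induction_on with
  | _ n ih =>
  intro V _ _ _ q hn hq hL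
  obtain ⟨W, hW, hd⟩ := hL
  rcases Nat.eq_zero_or_pos n with h0 | hpos
  · refine ⟨0, by omega, ?_⟩
    have hs : Subsingleton V := Module.finrank_zero_iff.1 (hn.trans h0)
    let e : V ≃ₗ[K] (Fin 0 → K) :=
      { toFun := fun _ => 0, invFun := fun _ => 0
        map_add' := by intros; simp
        map_smul' := by intros; simp
        left_inv := fun x => Subsingleton.elim _ _
        right_inv := fun x => Subsingleton.elim _ _ }
    refine ⟨⟨e, fun x => ?_⟩⟩
    have : x = 0 := Subsingleton.elim _ _
    subst this
    rw [QuadraticMap.map_zero]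
    erw [_root_.map_zero]
  · have hWpos : 0 < Module.finrank K W := by omega
    have : Nontrivial W := Module.finrank_pos_iff.1 hWpos
    obtain ⟨⟨w, hwW⟩, hw⟩ := exists_ne (0 : W)
    have hw0 : w ≠ 0 := fun h => hw (by simp [h])
    obtain ⟨w', i, hi, hiq⟩ := exists_plane hq hw0 (hW w hwW)
    obtain ⟨P, hP, ⟨e⟩⟩ := split q (binQ 1) i hiq (nd_bin one_ne_zero)
    have hnd := (nd_prod.1 (nd_of_equivalent ⟨e.symm⟩ hq)).2
    have hfr : Module.finrank K P + 2 = n := by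
      have := e.toLinearEquiv.finrank_eq
      rw [Module.finrank_prod, Module.finrank_fin_fun] at this
      omega
    have hpolW : ∀ x ∈ W, ∀ y ∈ W, polar q x y = 0 := by
      intro x hx y hy
      simp [polar, hW _ (W.add_mem hx hy), hW _ hx, hW _ hy]
    have hle : W ⊓ LinearMap.ker (polarBilin q w') ≤ P := by
      rintro x ⟨hxW, hx⟩
      rw [hP]
      intro a
      have hx' : polar q w' x = 0 := by simpa using hx
      rw [hi, polar_add_left, polar_smul_left, polar_smul_left, hx', hpolW w hwW x hxW]
      simp
    have hdim : Module.finrank K W ≤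
        Module.finrank K (W ⊓ LinearMap.ker (polarBilin q w') : Submodule K V) + 1 := by
      have h1 := Submodule.finrank_sup_add_finrank_inf_eq W (LinearMap.ker (polarBilin q w'))
      have h2 := (polarBilin q w').finrank_range_add_finrank_ker
      have h3 : Module.finrank K (LinearMap.range (polarBilin q w')) ≤ 1 := by
        refine (Submodule.finrank_le _).trans ?_
        simp
      have h4 := Submodule.finrank_le (W ⊔ LinearMap.ker (polarBilin q w'))
      omega
    have hLP : Lag (q.comp P.subtype) := by
      refine ⟨(W ⊓ LinearMap.ker (polarBilin q w')).comap P.subtype, ?_, ?_⟩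
      · intro x hx
        exact hW _ hx.1
      · have : Module.finrank K ((W ⊓ LinearMap.ker (polarBilin q w')).comap P.subtype)
            = Module.finrank K (W ⊓ LinearMap.ker (polarBilin q w') : Submodule K V) :=
          (Submodule.comapSubtypeEquivOfLe hle).finrank_eq
        omega
    obtain ⟨m, hm, hmE⟩ := ih (Module.finrank K P) (by omega) rfl hnd hLP
    refine ⟨m + 1, by omega, ?_⟩
    exact Equivalent.trans ⟨e.symm⟩ (Equivalent.prod (Equivalent.refl (binQ 1)) hmE)

theorem isHyperbolic_iff {K : Type} [Field K] [Invertible (2 : K)] (φ : QF K) :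
    φ.IsHyperbolic ↔ ND φ.q ∧ Lag φ.q := by
  constructor
  · rintro ⟨m, h⟩
    exact ⟨nd_of_equivalent (Equivalent.symm h) (nd_hyperbolics m),
      Lag.equivalent (Equivalent.symm h) (lag_hyperbolics m)⟩
  · rintro ⟨h1, h2⟩
    obtain ⟨m, -, hm⟩ := hyperbolic_of_lag _ rfl h1 h2
    exact ⟨m, hm⟩

theorem equivalent_of_lag {K V : Type} [Field K] [Invertible (2 : K)] 
    [AddCommGroup V] [Module K V] [FiniteDimensional K V] {q r : QuadraticForm K V}
    (hq : ND q) (hr : ND r) (h1 : Lag q) (h2 : Lag r) : q.Equivalent r := by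
  obtain ⟨m, hm, e⟩ := hyperbolic_of_lag _ rfl hq h1
  obtain ⟨m', hm', e'⟩ := hyperbolic_of_lag _ rfl hr h2
  have : m = m' := by omega
  subst this
  exact e.trans e'.symm

theorem Lag.smul {K V : Type} [Field K] 
    [AddCommGroup V] [Module K V] {q : QuadraticForm K V} (h : Lag q) (a : K) : Lag (a • q) := by
  obtain ⟨W, hW, hd⟩ := h
  exact ⟨W, fun w hw => by simp [hW w hw], hd⟩

theorem similar_of_lag {K V : Type} [Field K] [Invertible (2 : K)] 
    [AddCommGroup V] [Module K V] [FiniteDimensional K V] {q : QuadraticForm K V}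
    (hq : ND q) {a : K} (ha : a ≠ 0) (h : Lag (q.prod ((-a) • q))) : (a • q).Equivalent q := by
  have hna : -a ≠ 0 := neg_ne_zero.2 ha
  have hL : Lag ((a • q).prod ((-a) • q)) := by
    refine ⟨LinearMap.range (LinearMap.prod (LinearMap.id : V →ₗ[K] V) LinearMap.id), ?_, ?_⟩
    · rintro _ ⟨x, rfl⟩
      simp
    · rw [LinearMap.finrank_range_of_inj, Module.finrank_prod]
      · omega
      · intro x y hxy
        exact congrArg Prod.fst hxy
  have h1 := equivalent_of_lag (nd_prod.2 ⟨nd_smul ha hq, nd_smul hna hq⟩)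
    (nd_prod.2 ⟨hq, nd_smul hna hq⟩) hL h
  exact witt_cancel _ rfl (nd_smul hna hq)
    ((Equivalent.trans ⟨IsometryEquiv.prodComm _ _⟩ h1).trans ⟨IsometryEquiv.prodComm _ _⟩)

end SM

namespace SM
open Polynomial

theorem tower {K E L : Type} [Field K] [Field E] [Field L] [Algebra K E] [Algebra E L] [Algebra K L]
    [IsScalarTower K E L] [FiniteDimensional K E] [FiniteDimensional E L]
    (s1 : E →ₗ[K] K) (U1 : Submodule K E) (s2 : L →ₗ[E] E) (U2 : Submodule E L)
    (h21 : s2 1 = 1) (hU2 : ∀ u ∈ U2, s2 u = 0) (hUU2 : ∀ u ∈ U2, ∀ u' ∈ U2, s2 (u * u') = 0)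
    (hUU1 : ∀ u ∈ U1, ∀ u' ∈ U1, s1 (u * u') = 0) :
    ∃ (s : L →ₗ[K] K) (U : Submodule K L), (∀ z : E, s (algebraMap E L z) = s1 z) ∧
      (∀ u ∈ U, ∀ u' ∈ U, s (u * u') = 0) ∧
      (∀ z : E, (∀ u ∈ U1, s1 (z * u) = 0) → ∀ u ∈ U, s (algebraMap E L z * u) = 0) ∧
      Module.finrank K U = Module.finrank K E * Module.finrank E U2 + Module.finrank K U1 := by
  have : FiniteDimensional K L := FiniteDimensional.trans K E L
  have hs2 : ∀ (z : E) (l : L), s2 (algebraMap E L z * l) = z * s2 l := by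
    intro z l
    rw [← Algebra.smul_def, map_smul, smul_eq_mul]
  have hs2' : ∀ (z : E), s2 (algebraMap E L z) = z := by
    intro z
    have := hs2 z 1
    rwa [mul_one, h21, mul_one] at this
  let ι : E →ₗ[K] L := (IsScalarTower.toAlgHom K E L).toLinearMap
  have hι : ∀ z, ι z = algebraMap E L z := fun z => rfl
  let s : L →ₗ[K] K := s1.comp (s2.restrictScalars K)
  have hs : ∀ l, s l = s1 (s2 l) := fun l => rfl
  let A : Submodule K L := U2.restrictScalars K
  have hA : ∀ l, l ∈ A ↔ l ∈ U2 := fun l => Iff.rfl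
  let B : Submodule K L := U1.map ι
  refine ⟨s, A ⊔ B, ?_, ?_, ?_, ?_⟩
  · intro z; rw [hs, hs2']
  · intro u hu u' hu'
    obtain ⟨a, ha, b, hb, rfl⟩ := Submodule.mem_sup.1 hu
    obtain ⟨a', ha', b', hb', rfl⟩ := Submodule.mem_sup.1 hu'
    obtain ⟨z, hz, rfl⟩ := hb
    obtain ⟨z', hz', rfl⟩ := hb'
    rw [hι, hι]
    have : (a + algebraMap E L z) * (a' + algebraMap E L z') =
      a * a' + algebraMap E L z * a' + algebraMap E L z' * a + algebraMap E L (z * z') := by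
      rw [map_mul]; ring
    rw [hs, this, map_add s2, map_add s2, map_add s2, hUU2 a ha a' ha', hs2, hs2, hU2 a ha, hU2 a' ha', hs2']
    simp [hUU1 z hz z' hz']
  · intro z hz u hu
    obtain ⟨a, ha, b, hb, rfl⟩ := Submodule.mem_sup.1 hu
    obtain ⟨z', hz', rfl⟩ := hb
    rw [hι, hs, mul_add, ← map_mul, map_add, hs2, hs2', hU2 a ha]
    simp [hz z' hz']
  · have hd : A ⊓ B = ⊥ := by
      rw [eq_bot_iff]
      rintro _ ⟨ha, ⟨z, hz, rfl⟩⟩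
      have h1 : s2 (ι z) = 0 := hU2 _ ha
      rw [hι, hs2'] at h1
      simp [h1]
    have h1 := Submodule.finrank_sup_add_finrank_inf_eq A B
    rw [hd, finrank_bot] at h1
    have hB : Module.finrank K B = Module.finrank K U1 :=
      (Submodule.equivMapOfInjective ι (algebraMap E L).injective U1).finrank_eq.symm
    have hA' : Module.finrank K A = Module.finrank K E * Module.finrank E U2 :=
      (Module.finrank_mul_finrank K E U2).symm
    omega

theorem pb_functional {K E : Type} [Field K] [Field E] [Algebra K E] (pb : PowerBasis K E) :
    ∃ s : E →ₗ[K] K, s 1 = 1 ∧ (∀ i, 0 < i → i < pb.dim → s (pb.gen ^ i) = 0) ∧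
      s (pb.gen ^ pb.dim) = - (minpoly K pb.gen).coeff 0 := by
  have h0 : 0 < pb.dim := pb.dim_pos
  let s : E →ₗ[K] K := pb.basis.coord ⟨0, h0⟩
  have hs : ∀ i (hi : i < pb.dim), s (pb.gen ^ i) = if i = 0 then 1 else 0 := by
    intro i hi
    have h1 : pb.gen ^ i = pb.basis ⟨i, hi⟩ := by rw [pb.basis_eq_pow]
    rw [h1]
    simp only [s, Module.Basis.coord_apply, Module.Basis.repr_self, Finsupp.single_apply, Fin.mk.injEq]
  have hfin : FiniteDimensional K E := pb.finite
  refine ⟨s, by simpa using hs 0 h0, fun i hi hid => by rw [hs i hid, if_neg hi.ne'], ?_⟩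
  have hint : IsIntegral K pb.gen := pb.isIntegral_gen
  have hm := (minpoly.monic hint).as_sum
  have hdeg : (minpoly K pb.gen).natDegree = pb.dim := pb.natDegree_minpoly
  have h1 : aeval pb.gen (minpoly K pb.gen) = 0 := minpoly.aeval _ _
  rw [hm, hdeg] at h1
  simp only [map_add, map_pow, aeval_X, map_sum, map_mul, aeval_C] at h1
  have h2 : pb.gen ^ pb.dim = - ∑ i ∈ Finset.range pb.dim, (minpoly K pb.gen).coeff i • pb.gen ^ i := by
    simp only [Algebra.smul_def]
    exact eq_neg_of_add_eq_zero_left h1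
  rw [h2, map_neg, map_sum, Finset.sum_eq_single 0]
  · rw [map_smul, hs 0 h0]; simp
  · intro i hi hi0
    rw [map_smul, hs i (Finset.mem_range.1 hi), if_neg hi0, smul_zero]
  · intro h; exact absurd (Finset.mem_range.2 h0) h

theorem pb_space {K E : Type} [Field K] [Field E] [Algebra K E] (pb : PowerBasis K E) 
    (s : E →ₗ[K] K) (hs : ∀ i, 0 < i → i < pb.dim → s (pb.gen ^ i) = 0) (k : ℕ)
    (hk : k < pb.dim) :
    ∃ U : Submodule K E, Module.finrank K U = k ∧
      (∀ m, m + k < pb.dim → ∀ u ∈ U, s (pb.gen ^ m * u) = 0) ∧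
      (2 * k < pb.dim → ∀ u ∈ U, ∀ u' ∈ U, s (u * u') = 0) := by
  let f : Fin k → E := fun i => pb.gen ^ (i.1 + 1)
  have hf : LinearIndependent K f := by
    have h1 := pb.basis.linearIndependent.comp (fun i : Fin k => (⟨i.1 + 1, by omega⟩ : Fin pb.dim))
      (by intro i j h; simp at h; exact Fin.ext h)
    have h2 : f = pb.basis ∘ fun i : Fin k => (⟨i.1 + 1, by omega⟩ : Fin pb.dim) := by
      funext i
      simp only [f, Function.comp, pb.basis_eq_pow]
    rw [h2]
    exact h1
  refine ⟨Submodule.span K (Set.range f), ?_, ?_, ?_⟩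
  · rw [finrank_span_eq_card hf]; simp
  · intro m hm u hu
    induction hu using Submodule.span_induction with
    | mem x hx =>
      obtain ⟨i, rfl⟩ := hx
      simp only [f]
      rw [← pow_add]
      exact hs _ (by omega) (by omega)
    | zero => simp
    | add x y _ _ hx hy => rw [mul_add, map_add, hx, hy, add_zero]
    | smul c x _ hx => rw [mul_smul_comm, map_smul, hx, smul_zero]
  · intro h2 u hu u' hu'
    induction hu using Submodule.span_induction with
    | mem x hx =>
      obtain ⟨i, rfl⟩ := hx
      induction hu' using Submodule.span_induction with
      | mem x hx =>
        obtain ⟨j, rfl⟩ := hx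
        simp only [f]
        rw [← pow_add]
        exact hs _ (by omega) (by omega)
      | zero => simp
      | add x y _ _ hx hy => rw [mul_add, map_add, hx, hy, add_zero]
      | smul c x _ hx => rw [mul_smul_comm, map_smul, hx, smul_zero]
    | zero => simp
    | add x y _ _ hx hy => rw [add_mul, map_add, hx, hy, add_zero]
    | smul c x _ hx => rw [smul_mul_assoc, map_smul, hx, smul_zero]

/-- transfer data for odd degree extensions -/
def OddData (K L : Type) [Field K] [Field L] [Algebra K L] : Prop :=
  ∃ (s : L →ₗ[K] K) (U : Submodule K L), s 1 = 1 ∧ (∀ u ∈ U, s u = 0) ∧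
    (∀ u ∈ U, ∀ u' ∈ U, s (u * u') = 0) ∧ Module.finrank K L = 2 * Module.finrank K U + 1

theorem oddData_pb {K E : Type} [Field K] [Field E] [Algebra K E] (pb : PowerBasis K E)
    (h : Odd (Module.finrank K E)) : OddData K E := by
  obtain ⟨k, hk⟩ := h
  obtain ⟨s, h1, h2, -⟩ := pb_functional pb
  have hd : Module.finrank K E = pb.dim := pb.finrank
  obtain ⟨U, hU, hU1, hU2⟩ := pb_space pb s h2 k (by omega)
  refine ⟨s, U, h1, fun u hu => ?_, hU2 (by omega), by omega⟩
  simpa using hU1 0 (by omega) u hu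

theorem oddData : ∀ (n : ℕ) (K L : Type) [Field K] [Field L] [Algebra K L]
    [FiniteDimensional K L], Module.finrank K L = n → Odd n → OddData K L := by
  intro n
  induction n using Nat.strong_induction_on with
  | _ n ih =>
  intro K L _ _ _ _ hn hodd
  by_cases h1 : n = 1
  · obtain ⟨s, hs⟩ := LinearMap.exists_leftInverse_of_injective (Algebra.linearMap K L)
      (LinearMap.ker_eq_bot.2 (algebraMap K L).injective)
    refine ⟨s, ⊥, ?_, ?_, ?_, ?_⟩
    · have := LinearMap.congr_fun hs 1
      simpa using this
    · intro u hu
      rw [(Submodule.mem_bot K).1 hu, map_zero]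
    · intro u hu u' _
      rw [(Submodule.mem_bot K).1 hu, zero_mul, map_zero]
    · rw [finrank_bot]; omega
  · have : ∃ a : L, a ∉ (⊥ : IntermediateField K L) := by
      by_contra! h
      apply h1
      rw [← hn]
      exact IntermediateField.bot_eq_top_iff_finrank_eq_one.1 (eq_top_iff.2 (fun x _ => h x))
    obtain ⟨a, ha⟩ := this
    let F := IntermediateField.adjoin K {a}
    have hF1 : Module.finrank K F ≠ 1 := by
      intro h
      exact ha (IntermediateField.finrank_adjoin_simple_eq_one_iff.1 h)
    have hmul : Module.finrank K F * Module.finrank F L = n := by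
      rw [Module.finrank_mul_finrank, hn]
    have ho := hodd
    rw [← hmul, Nat.odd_mul] at ho
    have hFpos : 0 < Module.finrank K F := Module.finrank_pos
    have hLpos : 0 < Module.finrank F L := Module.finrank_pos
    have hlt : Module.finrank F L < n := by
      rw [← hmul]; nlinarith [Nat.lt_of_le_of_ne hFpos (Ne.symm hF1)]
    obtain ⟨s2, U2, a1, a2, a3, a4⟩ := ih _ hlt F L rfl ho.2
    obtain ⟨s1, U1, b1, b2, b3, b4⟩ := oddData_pb
      (IntermediateField.adjoin.powerBasis (Algebra.IsIntegral.isIntegral (R := K) a)) ho.1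
    obtain ⟨s, U, c1, c2, c3, c4⟩ := tower s1 U1 s2 U2 a1 a2 a3 b3
    refine ⟨s, U, ?_, ?_, c2, ?_⟩
    · have := c1 1
      rwa [map_one, b1] at this
    · intro u hu
      have := c3 1 (fun u hu => by rw [one_mul, b2 u hu]) u hu
      rwa [map_one, one_mul] at this
    · rw [c4, hn, ← hmul]
      change Module.finrank K F = _ at b4
      rw [a4, b4]; ring

theorem norm_data {K L : Type} [Field K] [Field L] [Algebra K L] [FiniteDimensional K L]
    (x : L) : IsSquare (Algebra.norm K x) ∨ OddData K L ∨
    ∃ (s : L →ₗ[K] K) (U : Submodule K L) (y : L) (M r : K), 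
      Algebra.norm K x = M * r ^ 2 ∧ s 1 = 1 ∧ s y = 0 ∧ s (y * y) = - M ∧
      (∀ u ∈ U, s u = 0) ∧ (∀ u ∈ U, s (y * u) = 0) ∧
      (∀ u ∈ U, ∀ u' ∈ U, s (u * u') = 0) ∧ Module.finrank K L = 2 * Module.finrank K U + 2 := by
  let F := IntermediateField.adjoin K {x}
  let pb : PowerBasis K F :=
    IntermediateField.adjoin.powerBasis (Algebra.IsIntegral.isIntegral (R := K) x)
  have hgen : algebraMap F L pb.gen = x := by
    simp only [pb, IntermediateField.adjoin.powerBasis_gen]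
    exact IntermediateField.AdjoinSimple.algebraMap_gen K x
  have hmul : Module.finrank K F * Module.finrank F L = Module.finrank K L :=
    Module.finrank_mul_finrank _ _ _
  have hN : Algebra.norm K x = (Algebra.norm K pb.gen) ^ Module.finrank F L := by
    rw [← Algebra.norm_norm (S := F), ← hgen, Algebra.norm_algebraMap, map_pow]
  rcases Nat.even_or_odd (Module.finrank F L) with he | ho
  · left
    rw [hN]; exact he.isSquare_pow _
  right
  rcases Nat.even_or_odd (Module.finrank K F) with he' | ho'
  swap
  · left
    exact oddData _ K L rfl (by rw [← hmul]; exact ho'.mul ho)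
  right
  obtain ⟨s2, U2, a1, a2, a3, a4⟩ := oddData _ F L rfl ho
  obtain ⟨k, hk⟩ := he'
  have hd : Module.finrank K F = pb.dim := pb.finrank
  have hpos : 0 < Module.finrank K F := Module.finrank_pos
  obtain ⟨s1, h1, h2, h3⟩ := pb_functional pb
  obtain ⟨U1, hU, hU1, hU2⟩ := pb_space pb s1 h2 (k - 1) (by omega)
  obtain ⟨s, U, c1, c2, c3, c4⟩ := tower s1 U1 s2 U2 a1 a2 a3 (hU2 (by omega))
  obtain ⟨j, hj⟩ := ho
  refine ⟨s, U, algebraMap F L (pb.gen ^ k), Algebra.norm K pb.gen, (Algebra.norm K pb.gen) ^ j,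
    ?_, ?_, ?_, ?_, ?_, ?_, c2, ?_⟩
  · rw [hN, hj]; ring
  · have := c1 1
    rwa [map_one, h1] at this
  · rw [c1, h2 k (by omega) (by omega)]
  · rw [← map_mul, c1, ← pow_add, ← hk, hd, h3, Algebra.PowerBasis.norm_gen_eq_coeff_zero_minpoly, ← hd, hk]
    simp
  · intro u hu
    have := c3 1 (fun u hu => by simpa using hU1 0 (by omega) u hu) u hu
    rwa [map_one, one_mul] at this
  · exact c3 _ (hU1 k (by omega))
  · rw [c4, ← hmul, a4, hU]
    have : Module.finrank K F = 2 * (k - 1) + 2 := by omega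
    rw [this]; ring

end SM

namespace SM
open QuadraticMap

theorem lag_transfer {K M P : Type} [Field K] [AddCommGroup M] [Module K M] [FiniteDimensional K M]
    [AddCommGroup P] [Module K P] [FiniteDimensional K P] (β : LinearMap.BilinForm K M)
    (hs : ∀ x y, β x y = β y x) (hβ : β.Nondegenerate) (W U : Submodule K M) (ρ : P →ₗ[K] M)
    (hW : ∀ w ∈ W, ∀ w' ∈ W, β w w' = 0) (hU : ∀ w ∈ U, ∀ w' ∈ U, β w w' = 0)
    (hρU : ∀ p, ∀ u ∈ U, β (ρ p) u = 0) (hinj : ∀ p, ρ p ∈ U → p = 0)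
    (hdim : Module.finrank K M = 2 * Module.finrank K U + Module.finrank K P)
    (hWd : Module.finrank K M ≤ 2 * Module.finrank K W) :
    ∃ T : Submodule K P, (∀ p ∈ T, ∀ p' ∈ T, β (ρ p) (ρ p') = 0) ∧
      Module.finrank K P ≤ 2 * Module.finrank K T := by
  refine ⟨(W ⊔ U).comap ρ, ?_, ?_⟩
  · intro p hp p' hp'
    obtain ⟨w, hw, u, hu, h⟩ := Submodule.mem_sup.1 hp
    obtain ⟨w', hw', u', hu', h'⟩ := Submodule.mem_sup.1 hp'
    have e1 : w = ρ p - u := by rw [← h]; abel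
    have e2 : w' = ρ p' - u' := by rw [← h']; abel
    have h0 := hW w hw w' hw'
    rw [e1, e2] at h0
    simp only [map_sub, LinearMap.sub_apply] at h0
    rw [hρU p u' hu', hs u, hρU p' u hu, hU u hu u' hu'] at h0
    simpa using h0
  · set T := (W ⊔ U).comap ρ with hT
    set R := LinearMap.range ρ with hR
    have hρinj : Function.Injective ρ := by
      rw [← LinearMap.ker_eq_bot, LinearMap.ker_eq_bot']
      intro p hp
      exact hinj p (by rw [hp]; exact U.zero_mem)
    have hUR : U ⊓ R = ⊥ := by
      rw [eq_bot_iff]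
      rintro _ ⟨hu, ⟨p, rfl⟩⟩
      rw [hinj p hu]; simp
    have h1 := Submodule.finrank_sup_add_finrank_inf_eq U R
    rw [hUR, finrank_bot, LinearMap.finrank_range_of_inj hρinj] at h1
    have h2 := Submodule.finrank_sup_add_finrank_inf_eq W U
    have h3 := Submodule.finrank_sup_add_finrank_inf_eq (U ⊔ R) (W ⊔ U)
    have h4 : (U ⊔ R) ⊔ (W ⊔ U) ≤ β.orthogonal (W ⊓ U) := by
      refine sup_le (sup_le ?_ ?_) (sup_le ?_ ?_)
      · intro x hx y hy; exact hU y hy.2 x hx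
      · rintro _ ⟨p, rfl⟩ y hy
        exact (hs _ _).trans (hρU p y hy.2)
      · intro x hx y hy; exact hW y hy.1 x hx
      · intro x hx y hy; exact hU y hy.2 x hx
    have h5 := Submodule.finrank_mono h4
    rw [LinearMap.BilinForm.finrank_orthogonal hβ] at h5
    have h6 : (U ⊔ R) ⊓ (W ⊔ U) ≤ U ⊔ T.map ρ := by
      rintro x ⟨hx1, hx2⟩
      obtain ⟨u, hu, _, ⟨p, rfl⟩, rfl⟩ := Submodule.mem_sup.1 hx1
      refine Submodule.add_mem_sup hu ⟨p, ?_, rfl⟩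
      have := (W ⊔ U).sub_mem hx2 ((le_sup_right : U ≤ W ⊔ U) hu)
      simpa [hT] using this
    have h7 := Submodule.finrank_mono h6
    have h8 := Submodule.finrank_add_le_finrank_add_finrank U (T.map ρ)
    have h9 : Module.finrank K (T.map ρ) = Module.finrank K T :=
      (Submodule.equivMapOfInjective ρ hρinj T).finrank_eq.symm
    have h10 := Submodule.finrank_le (W ⊓ U)
    omega

theorem finrank_restrict {K L M : Type} [Field K] [Field L] [Algebra K L] [AddCommGroup M]
    [Module K M] [Module L M] [IsScalarTower K L M] (W : Submodule L M) :
    Module.finrank K (W.restrictScalars K) = Module.finrank K L * Module.finrank L W :=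
  (Module.finrank_mul_finrank K L W).symm

theorem polar_baseChange {K L V : Type} [Field K] [Invertible (2 : K)] [Field L] [Algebra K L]
    [AddCommGroup V] [Module K V] (q : QuadraticForm K V) (a b : L) (v w : V) :
    polar (QuadraticForm.baseChange L q) (a ⊗ₜ[K] v) (b ⊗ₜ[K] w) =
      algebraMap K L (polar q v w) * (a * b) := by
  have h0 : (2 : L) ≠ 0 := by
    have := (map_ne_zero (algebraMap K L)).2 (two_ne (K := K))
    rwa [map_ofNat] at this
  letI : Invertible (2 : L) := invertibleOfNonzero h0
  have h1 := QuadraticForm.polarBilin_baseChange (A := L) q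
  have h2 := LinearMap.congr_fun (LinearMap.congr_fun h1 (a ⊗ₜ[K] v)) (b ⊗ₜ[K] w)
  rw [LinearMap.BilinForm.baseChange_tmul, polarBilin_apply_apply, polarBilin_apply_apply,
    Algebra.smul_def] at h2
  exact h2

theorem nd_baseChange {K L V : Type} [Field K] [Invertible (2 : K)] [Field L] [Algebra K L]
    [AddCommGroup V] [Module K V] [FiniteDimensional K V] {q : QuadraticForm K V} (hq : ND q) :
    ND (QuadraticForm.baseChange L q) := by
  intro z hz
  have hB := (nd_iff q).2 hq
  let b := Module.finBasis K V
  let b' := LinearMap.BilinForm.dualBasis (polarBilin q) hB b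
  let c := Algebra.TensorProduct.basis L b'
  apply c.ext_elem
  intro j
  rw [_root_.map_zero, Finsupp.zero_apply]
  have h1 := hz (1 ⊗ₜ[K] b j)
  have h2 : ∑ i, c.repr z i • c i = z := c.sum_repr z
  have h3 : polarBilin (QuadraticForm.baseChange L q) (∑ i, c.repr z i • c i) (1 ⊗ₜ[K] b j) = 0 := by
    rw [h2]; simpa using h1
  rw [map_sum, LinearMap.sum_apply, Finset.sum_eq_single j] at h3
  · rw [map_smul, LinearMap.smul_apply, polarBilin_apply_apply, Algebra.TensorProduct.basis_apply,
      polar_baseChange] at h3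
    have h4 := LinearMap.BilinForm.apply_dualBasis_left (B := polarBilin q) hB b j j
    rw [polarBilin_apply_apply] at h4
    simp only [b'] at h3
    rw [h4] at h3
    simpa using h3
  · intro i _ hij
    rw [map_smul, LinearMap.smul_apply, polarBilin_apply_apply, Algebra.TensorProduct.basis_apply,
      polar_baseChange]
    have h4 := LinearMap.BilinForm.apply_dualBasis_left (B := polarBilin q) hB b i j
    rw [polarBilin_apply_apply] at h4
    simp only [b']
    rw [h4, if_neg (Ne.symm hij)]
    simp
  · simp

theorem transfer {K L V P : Type} [Field K] [Invertible (2 : K)] [Field L] [Algebra K L]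
    [FiniteDimensional K L]
    [AddCommGroup V] [Module K V] [FiniteDimensional K V] {q : QuadraticForm K V} (hq : ND q)
    [AddCommGroup P] [Module K P] [FiniteDimensional K P] {r : QuadraticForm K P} (hr : ND r)
    (hL : Lag (QuadraticForm.baseChange L q)) (s : L →ₗ[K] K) (U : Submodule K L) (h1 : s 1 = 1)
    (hUU : ∀ u ∈ U, ∀ u' ∈ U, s (u * u') = 0)
    (ρ : P →ₗ[K] L ⊗[K] V)
    (hρ : ∀ p p', s (polar (QuadraticForm.baseChange L q) (ρ p) (ρ p')) = polar r p p')
    (hρU : ∀ p, ∀ u ∈ U, ∀ v : V,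
      s (polar (QuadraticForm.baseChange L q) (ρ p) (u ⊗ₜ[K] v)) = 0)
    (hdim : Module.finrank K L * Module.finrank K V =
      2 * (Module.finrank K U * Module.finrank K V) + Module.finrank K P) : Lag r := by
  have h2 := two_ne (K := K)
  set Q := QuadraticForm.baseChange L q with hQ
  have hQnd : ND Q := nd_baseChange hq
  let β : LinearMap.BilinForm K (L ⊗[K] V) := LinearMap.mk₂ K (fun m m' => s (polar Q m m'))
    (by intro a b c; rw [polar_add_left, map_add])
    (by intro a b c
        rw [← algebraMap_smul L a b, polar_smul_left, smul_eq_mul, ← Algebra.smul_def, map_smul])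
    (by intro a b c; rw [polar_add_right, map_add])
    (by intro a b c
        rw [← algebraMap_smul L a c, polar_smul_right, smul_eq_mul, ← Algebra.smul_def, map_smul])
  have hβ : ∀ m m', β m m' = s (polar Q m m') := fun m m' => rfl
  have hsymm : ∀ m m', β m m' = β m' m := fun m m' => by rw [hβ, hβ, polar_comm]
  have hleft : ∀ m, (∀ m', β m m' = 0) → m = 0 := by
    intro m hm
    apply hQnd
    intro m'
    by_contra hne
    have := hm ((polar Q m m')⁻¹ • m')
    rw [hβ, polar_smul_right, smul_eq_mul, inv_mul_cancel₀ hne, h1] at this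
    exact one_ne_zero this
  have hnd : β.Nondegenerate := ⟨hleft, fun m hm => hleft m (fun m' => by rw [hsymm]; exact hm m')⟩
  obtain ⟨W, hW, hWd⟩ := hL
  let U' : Submodule K (L ⊗[K] V) := LinearMap.range (LinearMap.rTensor V U.subtype)
  have hU'fr : Module.finrank K U' = Module.finrank K U * Module.finrank K V := by
    rw [LinearMap.finrank_range_of_inj, Module.finrank_tensorProduct]
    exact Module.Flat.rTensor_preserves_injective_linearMap _ U.subtype_injective
  have hind : ∀ m, (∀ u ∈ U, ∀ v : V, β m (u ⊗ₜ[K] v) = 0) → ∀ x ∈ U', β m x = 0 := by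
    rintro m hm _ ⟨x, rfl⟩
    induction x using TensorProduct.induction_on with
    | zero => simp
    | tmul u v => exact hm u u.2 v
    | add x y hx hy => rw [map_add, map_add, hx, hy, add_zero]
  have hρU' : ∀ p, ∀ u ∈ U', β (ρ p) u = 0 := fun p => hind _ (hρU p)
  have g1 : ∀ w ∈ W.restrictScalars K, ∀ w' ∈ W.restrictScalars K, β w w' = 0 := by
    intro w hw w' hw'
    have : polar Q w w' = 0 := by
      simp [polar, hW _ (W.add_mem hw hw'), hW _ hw, hW _ hw']
    rw [hβ, this, map_zero]
  have g2 : ∀ w ∈ U', ∀ w' ∈ U', β w w' = 0 := by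
    intro x hx
    apply hind
    intro u hu v
    rw [hsymm]
    revert x
    apply hind
    intro u' hu' v'
    rw [hβ, hQ, polar_baseChange, ← Algebra.smul_def, map_smul, hUU u hu u' hu', smul_zero]
  have g3 : ∀ p, ρ p ∈ U' → p = 0 := by
    intro p hp
    apply hr
    intro p'
    rw [← hρ, polar_comm]
    exact hρU' p' _ hp
  have g4 : Module.finrank K (L ⊗[K] V) = 2 * Module.finrank K U' + Module.finrank K P := by
    rw [Module.finrank_tensorProduct, hU'fr, hdim]
  have g5 : Module.finrank K (L ⊗[K] V) ≤ 2 * Module.finrank K (W.restrictScalars K) := by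
    have h3 : Module.finrank K (W.restrictScalars K) = Module.finrank K L * Module.finrank L W :=
      finrank_restrict W
    rw [h3, ← Module.finrank_mul_finrank K L]
    calc _ ≤ Module.finrank K L * (2 * Module.finrank L W) := Nat.mul_le_mul_left _ hWd
      _ = _ := by ring
  obtain ⟨T, hT, hTd⟩ := lag_transfer β hsymm hnd (W.restrictScalars K) U' ρ g1 g2 hρU' g3 g4 g5
  refine ⟨T, fun p hp => ?_, hTd⟩
  have h3 := hT p hp p hp
  rw [hβ, hρ, polar_self] at h3
  simpa [h2] using h3

theorem similar_trans {K V : Type} [Field K] [AddCommGroup V] [Module K V] {q : QuadraticForm K V}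
    {a b : K} (ha : (a • q).Equivalent q) (hb : (b • q).Equivalent q) :
    ((a * b) • q).Equivalent q := by
  obtain ⟨e⟩ := ha
  obtain ⟨f⟩ := hb
  refine ⟨⟨f.toLinearEquiv.trans e.toLinearEquiv, fun x => ?_⟩⟩
  have h1 := e.map_app (f x)
  have h2 := f.map_app x
  change q (e (f x)) = _
  rw [h1]
  simp only [FunLike.coe_smul, Pi.smul_apply, smul_eq_mul] at h2 ⊢
  rw [h2]; ring

theorem similar_sq {K V : Type} [Field K] [AddCommGroup V] [Module K V] {q : QuadraticForm K V}
    {a : K} (ha : a ≠ 0) : ((a * a) • q).Equivalent q := by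
  refine ⟨⟨LinearEquiv.smulOfNeZero K V a ha, fun x => ?_⟩⟩
  change q (a • x) = _
  rw [QuadraticMap.map_smul]
  simp

/-- the norm principle for extensions over which the form becomes hyperbolic -/
theorem norm_similar {K L V : Type} [Field K] [Invertible (2 : K)] [Field L] [Algebra K L]
    [FiniteDimensional K L]
    [AddCommGroup V] [Module K V] [FiniteDimensional K V] {q : QuadraticForm K V} (hq : ND q)
    (hL : Lag (QuadraticForm.baseChange L q)) (x : L) (hx : x ≠ 0) :
    ((Algebra.norm K x) • q).Equivalent q := by
  have hN : Algebra.norm K x ≠ 0 := Algebra.norm_ne_zero_iff.2 hx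
  rcases norm_data (K := K) x with ⟨a, ha⟩ | ⟨s, U, h1, h2, h3, h4⟩ |
    ⟨s, U, y, M, r, h0, h1, h2, h3, h4, h5, h6, h7⟩
  · rw [ha]
    apply similar_sq
    rintro rfl
    simp [hN] at ha
  · have hLq : Lag q := by
      refine transfer hq hq hL s U h1 h3 (TensorProduct.mk K L V 1) ?_ ?_ ?_
      · intro p p'
        rw [TensorProduct.mk_apply, TensorProduct.mk_apply, polar_baseChange, ← Algebra.smul_def,
          map_smul, mul_one, h1, smul_eq_mul, mul_one]
      · intro p u hu v
        rw [TensorProduct.mk_apply, polar_baseChange, ← Algebra.smul_def,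
          map_smul, one_mul, h2 u hu, smul_zero]
      · rw [h4]; ring
    exact equivalent_of_lag (nd_smul hN hq) hq (hLq.smul _) hLq
  · have hM : M ≠ 0 := by rintro rfl; simp [h0] at hN
    have hr : r ≠ 0 := by rintro rfl; simp [h0] at hN
    have hLr : Lag (q.prod ((-M) • q)) := by
      refine transfer hq (nd_prod.2 ⟨hq, nd_smul (neg_ne_zero.2 hM) hq⟩) hL s U h1 h6
        (LinearMap.coprod (TensorProduct.mk K L V 1) (TensorProduct.mk K L V y)) ?_ ?_ ?_
      · rintro ⟨p, p'⟩ ⟨t, t'⟩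
        have hsa : ∀ c : K, s (algebraMap K L c) = c := fun c => by
          rw [Algebra.algebraMap_eq_smul_one, map_smul, h1, smul_eq_mul, mul_one]
        simp only [LinearMap.coprod_apply, TensorProduct.mk_apply, polar_add_left, polar_add_right,
          polar_baseChange, map_add, ← Algebra.smul_def, map_smul, one_mul, mul_one, h1, h2, h3,
          polar_prod, FunLike.coe_smul, polar_smul]
        simp [hsa]
        ring
      · rintro ⟨p, p'⟩ u hu v
        simp only [LinearMap.coprod_apply, TensorProduct.mk_apply, polar_add_left, polar_add_right,
          polar_baseChange, map_add, ← Algebra.smul_def, map_smul, one_mul, h4 u hu, h5 u hu]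
        simp
      · rw [h7, Module.finrank_prod]; ring
    have h8 := similar_of_lag hq hM hLr
    rw [h0, pow_two]
    exact similar_trans h8 (similar_sq hr)

end SM

namespace SM
open QuadraticMap

theorem baseChange_comp {K L V W : Type} [Field K] [Invertible (2 : K)] [Field L] [Algebra K L]
    [AddCommGroup V] [Module K V] [AddCommGroup W] [Module K W] {q : QuadraticForm K V}
    {r : QuadraticForm K W} (i : V →ₗ[K] W) (hi : ∀ v, r (i v) = q v) (x : L ⊗[K] V) :
    QuadraticForm.baseChange L r (i.baseChange L x) = QuadraticForm.baseChange L q x := by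
  have h : (QuadraticForm.baseChange L r).comp (i.baseChange L) = QuadraticForm.baseChange L q := by
    apply baseChange_ext
    intro m
    simp [hi]
  exact congrArg (fun Q : QuadraticForm L (L ⊗[K] V) => Q x) h

theorem baseChange_equivalent {K L V W : Type} [Field K] [Invertible (2 : K)] [Field L]
    [Algebra K L]
    [AddCommGroup V] [Module K V] [AddCommGroup W] [Module K W] {q : QuadraticForm K V}
    {r : QuadraticForm K W} (h : q.Equivalent r) :
    (QuadraticForm.baseChange L q).Equivalent (QuadraticForm.baseChange L r) := by
  obtain ⟨e⟩ := h
  refine ⟨⟨e.toLinearEquiv.baseChange K L V W, fun x => ?_⟩⟩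
  exact baseChange_comp (L := L) (q := q) (r := r) e.toLinearEquiv.toLinearMap
    (fun v => e.map_app v) x

theorem baseChange_prod {K L V W : Type} [Field K] [Invertible (2 : K)] [Field L] [Algebra K L]
    [AddCommGroup V] [Module K V] [AddCommGroup W] [Module K W] (q : QuadraticForm K V)
    (r : QuadraticForm K W) :
    ((QuadraticForm.baseChange L q).prod (QuadraticForm.baseChange L r)).Equivalent
      (QuadraticForm.baseChange L (q.prod r)) := by
  let E := TensorProduct.prodRight K L L V W
  have h : ((QuadraticForm.baseChange L q).prod (QuadraticForm.baseChange L r)).comp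
      E.toLinearMap = QuadraticForm.baseChange L (q.prod r) := by
    apply baseChange_ext
    intro m
    simp [E, add_smul]
  refine Equivalent.symm ⟨⟨E, fun x => ?_⟩⟩
  exact congrArg (fun Q : QuadraticForm L (L ⊗[K] (V × W)) => Q x) h

theorem lag_of_isotropic {K V : Type} [Field K] [AddCommGroup V] [Module K V]
    {q : QuadraticForm K V} (hd : Module.finrank K V = 2) {w : V} (hw : w ≠ 0) (h : q w = 0) :
    Lag q := by
  refine ⟨Submodule.span K {w}, ?_, ?_⟩
  · intro x hx
    obtain ⟨a, rfl⟩ := Submodule.mem_span_singleton.1 hx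
    rw [QuadraticMap.map_smul, h, smul_zero]
  · rw [finrank_span_singleton hw, hd]

theorem lag_base_bin {K L : Type} [Field K] [Invertible (2 : K)] [Field L] [Algebra K L]
    (c t : K) (hc : c ≠ 0) (ht : t ≠ 0) (r : L) (hr : r * r = algebraMap K L t) :
    Lag (QuadraticForm.baseChange L (c • binQ t)) := by
  have h2 : (2 : L) ≠ 0 := by
    have := (map_ne_zero (algebraMap K L)).2 (two_ne (K := K))
    rwa [map_ofNat] at this
  have hL : ∀ {a : K}, a ≠ 0 → algebraMap K L a ≠ 0 := fun h => (map_ne_zero (algebraMap K L)).2 h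
  refine lag_of_isotropic (w := r ⊗ₜ[K] ![1, 0] + 1 ⊗ₜ[K] ![0, 1])
    (by rw [Module.finrank_baseChange]; simp) ?_ ?_
  · intro h0
    have h1 : polar (QuadraticForm.baseChange L (c • binQ t))
      (r ⊗ₜ[K] ![1, 0] + 1 ⊗ₜ[K] ![0, 1]) (1 ⊗ₜ[K] ![0, 1]) = 0 := by
      rw [h0]; simp
    rw [polar_add_left, polar_baseChange, polar_baseChange, FunLike.coe_smul, polar_smul,
      polar_smul, bin_polar, bin_polar] at h1
    simp [two_ne (K := K), h2, hL hc, hL ht] at h1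
  · rw [q_add, QuadraticForm.baseChange_tmul, QuadraticForm.baseChange_tmul, polar_baseChange,
      FunLike.coe_smul, polar_smul, bin_polar, hr]
    simp [bin_apply, Algebra.smul_def]

end SM

namespace SM
open QuadraticMap

theorem hensel_sq {K : Type} [Field K] (O : ValuationSubring K) [HenselianLocalRing O]
    (hres : (2 : IsLocalRing.ResidueField O) ≠ 0) {ε : K} (hε : O.valuation ε < 1) :
    ∃ u : K, u * u = 1 - ε ∧ u ≠ 0 := by
  have hεO : ε ∈ O := (O.valuation_le_one_iff ε).1 hε.le
  let e : O := ⟨ε, hεO⟩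
  have he : e ∈ IsLocalRing.maximalIdeal O := (O.valuation_lt_one_iff e).2 hε
  have h2 : IsUnit (2 : O) := by
    rw [← IsLocalRing.residue_ne_zero_iff_isUnit]
    rwa [map_ofNat]
  obtain ⟨a, ha, _⟩ := HenselianLocalRing.is_henselian (R := O)
    (Polynomial.X ^ 2 - Polynomial.C (1 - e)) (Polynomial.monic_X_pow_sub_C _ two_ne_zero) 1
    (by simpa using he) (by simpa [one_add_one_eq_two] using h2)
  have h1 : a ^ 2 = 1 - e := by
    have := ha
    simp only [Polynomial.IsRoot, Polynomial.eval_sub, Polynomial.eval_pow, Polynomial.eval_X,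
      Polynomial.eval_C] at this
    exact sub_eq_zero.1 this
  have h3 : (a : K) * a = 1 - ε := by
    have := congrArg (fun z : O => (z : K)) h1
    simpa [pow_two, e] using this
  refine ⟨a, h3, fun h0 => ?_⟩
  rw [h0, mul_zero] at h3
  have : ε = 1 := by linear_combination h3
  rw [this, map_one] at hε
  exact lt_irrefl _ hε

theorem smul_equivalent {K V W : Type} [Field K] [AddCommGroup V] [Module K V]
    [AddCommGroup W] [Module K W] {q : QuadraticForm K V} {r : QuadraticForm K W} (a : K)
    (h : q.Equivalent r) : (a • q).Equivalent (a • r) := by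
  obtain ⟨e⟩ := h
  exact ⟨⟨e.toLinearEquiv, fun x => by
    have := e.map_app x
    change a • r (e x) = a • q x
    rw [this]⟩⟩

theorem prod_equivalent {K V W V' W' : Type} [Field K] [AddCommGroup V] [Module K V]
    [AddCommGroup W] [Module K W] [AddCommGroup V'] [Module K V']
    [AddCommGroup W'] [Module K W'] {q : QuadraticForm K V} {r : QuadraticForm K W}
    {q' : QuadraticForm K V'} {r' : QuadraticForm K W'}
    (h : q.Equivalent q') (h' : r.Equivalent r') : (q.prod r).Equivalent (q'.prod r') := by
  obtain ⟨e⟩ := h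
  obtain ⟨e'⟩ := h'
  exact ⟨IsometryEquiv.prod e e'⟩

theorem bin_similar {K : Type} [Field K] {t : K} (c : K) (ht : t ≠ 0) :
    (t • (c • binQ (-t))).Equivalent (c • binQ (-t)) := by
  let E : (Fin 2 → K) ≃ₗ[K] (Fin 2 → K) :=
    { toFun := fun x => ![t * x 1, x 0]
      invFun := fun x => ![x 1, t⁻¹ * x 0]
      map_add' := fun x y => by ext i; fin_cases i <;> simp [mul_add]
      map_smul' := fun a x => by ext i; fin_cases i <;> simp; ring
      left_inv := fun x => by ext i; fin_cases i <;> simp [ht]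
      right_inv := fun x => by ext i; fin_cases i <;> simp [ht] }
  refine ⟨⟨E, fun x => ?_⟩⟩
  change (c • binQ (-t)) (![t * x 1, x 0]) = _
  simp [bin_apply]
  ring

theorem key_step {K L V A : Type} [Field K] [Invertible (2 : K)] [Field L] [Algebra K L]
    [AddCommGroup V] [Module K V] [FiniteDimensional K V]
    [AddCommGroup A] [Module K A] [FiniteDimensional K A]
    {q : QuadraticForm K V} (hq : ND q) {t : K} (hsim : (t • q).Equivalent q)
    (qA : QuadraticForm K A) (i : A →ₗ[K] V) (hi : ∀ a, q (i a) = qA a) (hA : ND qA)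
    (hpos : 0 < Module.finrank K A)
    (hAs : (t • qA).Equivalent qA) (hAL : Lag (QuadraticForm.baseChange L qA))
    (ih : ∀ {P : Type} [AddCommGroup P] [Module K P] [FiniteDimensional K P]
      {r : QuadraticForm K P}, Module.finrank K P < Module.finrank K V → ND r →
      (t • r).Equivalent r → Lag (QuadraticForm.baseChange L r)) :
    Lag (QuadraticForm.baseChange L q) := by
  obtain ⟨P, _, hP⟩ := split q qA i hi hA
  have hP : (qA.prod (q.comp P.subtype)).Equivalent q := hP
  set ψ := q.comp P.subtype with hψ
  have hnd := nd_of_equivalent (Equivalent.symm hP) hq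
  have hfr := finrank_eq_of_equivalent hP
  rw [Module.finrank_prod] at hfr
  have e1 : (qA.prod (t • ψ)).Equivalent ((t • qA).prod (t • ψ)) :=
    prod_equivalent (Equivalent.symm hAs) (Equivalent.refl _)
  have e2 : ((t • qA).prod (t • ψ)) = t • (qA.prod ψ) := by
    ext x
    simp [mul_add]
  rw [e2] at e1
  have e3 := ((e1.trans (smul_equivalent t hP)).trans hsim).trans (Equivalent.symm hP)
  have e4 := witt_cancel _ rfl hA e3
  have hL := ih (by omega) (nd_prod.1 hnd).2 e4
  exact Lag.equivalent ((baseChange_prod qA ψ).trans (baseChange_equivalent hP)) (hAL.prod hL)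

theorem key {K L : Type} [Field K] [Invertible (2 : K)] [Field L] [Algebra K L]
    (O : ValuationSubring K) [HenselianLocalRing O]
    (hres : (2 : IsLocalRing.ResidueField O) ≠ 0) {t : K} (ht : t ≠ 0)
    (hv : ¬ ∃ s : K, s ≠ 0 ∧ O.valuation t = (O.valuation s) ^ 2)
    (r : L) (hr : r * r = algebraMap K L (-t)) : ∀ (n : ℕ) {V : Type} [AddCommGroup V] [Module K V]
    [FiniteDimensional K V] {q : QuadraticForm K V}, Module.finrank K V = n → ND q →
    (t • q).Equivalent q → Lag (QuadraticForm.baseChange L q) := by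
  intro n
  induction n using Nat.strong_induction_on with
  | _ n IH =>
  intro V _ _ _ q hn hq hsim
  have ih : ∀ {P : Type} [AddCommGroup P] [Module K P] [FiniteDimensional K P]
      {r : QuadraticForm K P}, Module.finrank K P < Module.finrank K V → ND r →
      (t • r).Equivalent r → Lag (QuadraticForm.baseChange L r) := by
    intro P _ _ _ r h1 h2 h3
    exact IH _ (hn ▸ h1) rfl h2 h3
  have h2 := two_ne (K := K)
  by_cases hpos : Module.finrank K V = 0
  · refine ⟨⊥, by simp, ?_⟩
    rw [Module.finrank_baseChange, hpos]
    exact Nat.zero_le _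
  by_cases hiso : ∃ w, w ≠ 0 ∧ q w = 0
  · obtain ⟨w, hw, hqw⟩ := hiso
    obtain ⟨w', i, _, hi⟩ := exists_plane hq hw hqw
    have hnd : ND (binQ (1 : K)) := nd_bin one_ne_zero
    refine key_step hq hsim (binQ 1) i hi hnd (by simp)
      (equivalent_of_lag (nd_smul ht hnd) hnd (lag_bin.smul _) lag_bin) ?_ ih
    have := lag_base_bin (L := L) (1 : K) 1 one_ne_zero one_ne_zero 1 (by simp)
    rwa [one_smul] at this
  · push Not at hiso
    have haniso : ∀ w, q w = 0 → w = 0 := fun w hw => by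
      by_contra h
      exact hiso w h hw
    obtain ⟨y, hy⟩ := exists_ne_zero hq (Nat.pos_of_ne_zero hpos)
    have hsim' := hsim
    obtain ⟨e⟩ := hsim'
    have hx : q (e y) = t * q y := by
      rw [e.map_app]; simp
    set x := e y with hxdef
    set c := q y with hc
    set b := polar q x y with hb
    set s := b / (2 * c) with hs
    have hbs : b = 2 * s * c := by rw [hs]; field_simp
    have hqxy : ∀ l : K, q (x + l • y) = c * (t + 2 * l * s + l * l) := by
      intro l
      rw [q_add, hx, QuadraticMap.map_smul, polar_smul_right, ← hb, hbs, ← hc]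
      simp only [smul_eq_mul]
      ring
    have hnsq : ∀ l : K, t ≠ l * l := by
      intro l hl
      refine hv ⟨l, ?_, ?_⟩
      · rintro rfl
        exact ht (by simpa using hl)
      · rw [hl, map_mul, pow_two]
    have hvt : O.valuation t ≠ 0 := (Valuation.ne_zero_iff _).2 ht
    rcases lt_trichotomy (O.valuation (s * s / t)) 1 with hlt | heq | hgt
    · obtain ⟨u, hu, hu0⟩ := hensel_sq O hres hlt
      have hu' : t * (u * u) = t - s * s := by rw [hu]; field_simp
      let z := u⁻¹ • (x + (-s) • y)
      have hqz : q z = t * c := by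
        simp only [z]
        rw [QuadraticMap.map_smul, hqxy, smul_eq_mul]
        have : c * (t + 2 * -s * s + -s * -s) = c * (t * (u * u)) := by rw [hu']; ring
        rw [this]
        field_simp
      have hpz : polar q y z = 0 := by
        simp only [z]
        rw [polar_smul_right, polar_add_right, polar_smul_right, polar_self, polar_comm, ← hb,
          hbs, ← hc]
        simp only [smul_eq_mul]
        ring
      let i : (Fin 2 → K) →ₗ[K] V :=
        (LinearMap.toSpanSingleton K V y).comp (LinearMap.proj 0) +
        (LinearMap.toSpanSingleton K V z).comp (LinearMap.proj 1)
      have hi : ∀ a, q (i a) = (c • binQ (-t)) a := by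
        intro a
        have : i a = a 0 • y + a 1 • z := rfl
        rw [this, q_add, QuadraticMap.map_smul, QuadraticMap.map_smul, polar_smul_left,
          polar_smul_right, hpz, hqz, ← hc]
        simp [bin_apply]
        ring
      exact key_step hq hsim (c • binQ (-t)) i hi (nd_smul hy (nd_bin (neg_ne_zero.2 ht)))
        (by simp) (bin_similar c ht) (lag_base_bin c (-t) hy (neg_ne_zero.2 ht) r hr) ih
    · exfalso
      refine hv ⟨s, ?_, ?_⟩
      · intro h
        rw [h] at heq
        simp at heq
      · rw [map_div₀, map_mul, div_eq_one_iff_eq hvt] at heq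
        rw [← heq, pow_two]
    · exfalso
      have hs0 : s ≠ 0 := by
        intro h
        rw [h] at hgt
        simp at hgt
      have hlt : O.valuation (t / (s * s)) < 1 := by
        rw [← inv_div, map_inv₀]
        exact inv_lt_one_of_one_lt₀ hgt
      obtain ⟨w, hw, _⟩ := hensel_sq O hres hlt
      have hw' : s * s * (w * w) = s * s - t := by rw [hw]; field_simp
      have h0 : q (x + (-s + s * w) • y) = 0 := by
        rw [hqxy]
        linear_combination c * hw'
      have h1 := haniso _ h0
      have h3 : x = -((-s + s * w) • y) := eq_neg_of_add_eq_zero_left h1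
      have h4 : q x = (-s + s * w) * (-s + s * w) * c := by
        rw [h3, QuadraticMap.map_neg, QuadraticMap.map_smul, smul_eq_mul]
      rw [hx] at h4
      exact hnsq _ (mul_right_cancel₀ hy h4)

end SM

namespace SM
open QuadraticMap

theorem two_ext {K L : Type} [Field K] [Field L] [Algebra K L] (h : Module.finrank K L = 2) :
    IsTwoExtension K L := by
  have : FiniteDimensional K L := Module.finite_of_finrank_pos (by omega)
  refine ⟨this, 1, ![⊥, ⊤], rfl, rfl, ?_⟩
  intro i
  fin_cases i
  refine ⟨bot_le, ?_⟩
  change IntermediateField.relfinrank (⊥ : IntermediateField K L) ⊤ = 2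
  rw [IntermediateField.relfinrank_bot_left, IntermediateField.finrank_top', h]

theorem quad_ext {K : Type} [Field K] {t : K} (hns : ∀ l : K, -t ≠ l * l) :
    ∃ L : FieldExt K, Module.finrank K L.carrier = 2 ∧ ∃ r : L.carrier,
      r * r = algebraMap K L.carrier (-t) ∧ Algebra.norm K r = t := by
  let f : Polynomial K := Polynomial.X ^ 2 - Polynomial.C (-t)
  have hf : f.Monic := Polynomial.monic_X_pow_sub_C _ two_ne_zero
  have hd : f.natDegree = 2 := Polynomial.natDegree_X_pow_sub_C
  have hirr : Irreducible f := by
    apply X_pow_sub_C_irreducible_of_prime Nat.prime_two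
    intro b hb
    exact hns b (by rw [← hb, pow_two])
  haveI : Fact (Irreducible f) := ⟨hirr⟩
  let pb := AdjoinRoot.powerBasis hf.ne_zero
  have hroot : AdjoinRoot.root f * AdjoinRoot.root f = algebraMap K (AdjoinRoot f) (-t) := by
    have h := AdjoinRoot.eval₂_root f
    simp only [f, Polynomial.eval₂_sub, Polynomial.eval₂_pow, Polynomial.eval₂_X,
      Polynomial.eval₂_C] at h
    rw [← pow_two]
    exact sub_eq_zero.1 h
  refine ⟨⟨AdjoinRoot f⟩, ?_, AdjoinRoot.root f, hroot, ?_⟩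
  · exact pb.finrank.trans ((AdjoinRoot.powerBasis_dim hf.ne_zero).trans hd)
  · have h1 := Algebra.PowerBasis.norm_gen_eq_coeff_zero_minpoly pb
    have h2 : minpoly K pb.gen = f := by
      rw [AdjoinRoot.minpoly_powerBasis_gen_of_monic hf]
    rw [h2] at h1
    have h3 : pb.dim = 2 := (AdjoinRoot.powerBasis_dim hf.ne_zero).trans hd
    rw [h3] at h1
    change Algebra.norm K pb.gen = t
    rw [h1]
    simp [f]

theorem hyp2_mem {K : Type} [Field K] [Invertible (2 : K)] (O : ValuationSubring K)
    [HenselianLocalRing O] (hres : (2 : IsLocalRing.ResidueField O) ≠ 0)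
    (φ : QF K) (hφ : φ.Nondeg) {t : K} (ht : t ∈ QF.G φ)
    (hv : ¬ ∃ s : K, s ≠ 0 ∧ O.valuation t = (O.valuation s) ^ 2) :
    t ∈ QF.Hyp2 φ ∧ ∀ a : K, a ≠ 0 → a * a ∈ QF.Hyp2 φ := by
  obtain ⟨ht0, hsim⟩ := ht
  have hnd : ND φ.q := (nd_iff φ.q).1 hφ
  have hns : ∀ l : K, -t ≠ l * l := by
    intro l hl
    refine hv ⟨l, ?_, ?_⟩
    · rintro rfl
      exact ht0 (by simpa using hl)
    · rw [← Valuation.map_neg, hl, map_mul, pow_two]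
  obtain ⟨L, hL, r, hr, hN⟩ := quad_ext hns
  have hlag : Lag (QuadraticForm.baseChange L.carrier φ.q) :=
    key O hres ht0 hv r hr _ rfl hnd hsim
  have h2L : (2 : L.carrier) ≠ 0 := by
    have := (map_ne_zero (algebraMap K L.carrier)).2 (two_ne (K := K))
    rwa [map_ofNat] at this
  letI : Invertible (2 : L.carrier) := invertibleOfNonzero h2L
  have hh : QF.IsHyperbolic (QF.baseChange L.carrier φ) :=
    (isHyperbolic_iff _).2 ⟨nd_baseChange hnd, hlag⟩
  constructor
  · refine Submonoid.subset_closure ⟨L, two_ext hL, hh, r, ?_, hN⟩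
    rintro rfl
    rw [mul_zero] at hr
    exact ht0 (neg_eq_zero.1 ((map_eq_zero (algebraMap K L.carrier)).1 hr.symm))
  · intro a ha
    refine Submonoid.subset_closure ⟨L, two_ext hL, hh, algebraMap K L.carrier a,
      (map_ne_zero _).2 ha, ?_⟩
    rw [Algebra.norm_algebraMap, hL, pow_two]

theorem G_mul {K : Type} [Field K] {φ : QF K} {a b : K} (ha : a ∈ QF.G φ) (hb : b ∈ QF.G φ) :
    a * b ∈ QF.G φ :=
  ⟨mul_ne_zero ha.1 hb.1, similar_trans ha.2 hb.2⟩

theorem G_sq {K : Type} [Field K] {φ : QF K} {a : K} (ha : a ≠ 0) : a * a ∈ QF.G φ :=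
  ⟨mul_ne_zero ha ha, similar_sq ha⟩

theorem hyp_sub {K : Type} [Field K] [Invertible (2 : K)] (φ : QF K) (hφ : φ.Nondeg) {a : K}
    (ha : a ∈ QF.Hyp φ) : a ∈ QF.G φ := by
  have hnd : ND φ.q := (nd_iff φ.q).1 hφ
  induction ha using Submonoid.closure_induction with
  | mem x hx =>
    obtain ⟨L, hfd, hh, y, hy, rfl⟩ := hx
    have h2L : (2 : L.carrier) ≠ 0 := by
      have := (map_ne_zero (algebraMap K L.carrier)).2 (two_ne (K := K))
      rwa [map_ofNat] at this
    letI : Invertible (2 : L.carrier) := invertibleOfNonzero h2L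
    have hlag := ((isHyperbolic_iff _).1 hh).2
    exact ⟨Algebra.norm_ne_zero_iff.2 hy, norm_similar hnd hlag y hy⟩
  | one => simpa using G_sq (φ := φ) (one_ne_zero (α := K))
  | mul x y _ _ hx hy => exact G_mul hx hy

theorem hyp2_sub {K : Type} [Field K] [Invertible (2 : K)] (φ : QF K) :
    QF.Hyp2 φ ≤ QF.Hyp φ :=
  Submonoid.closure_mono fun _ ⟨L, h, hh, hn⟩ => ⟨L, h.1, hh, hn⟩

theorem G_sub {K : Type} [Field K] [Invertible (2 : K)] (O : ValuationSubring K)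
    [HenselianLocalRing O] (hres : (2 : IsLocalRing.ResidueField O) ≠ 0)
    (φ : QF K) (hφ : φ.Nondeg)
    (hv : ∃ t ∈ QF.G φ, ¬ ∃ s : K, s ≠ 0 ∧ O.valuation t = (O.valuation s) ^ 2)
    {a : K} (ha : a ∈ QF.G φ) : a ∈ QF.Hyp2 φ := by
  by_cases h : ∃ s : K, s ≠ 0 ∧ O.valuation a = (O.valuation s) ^ 2
  · obtain ⟨s, hs, has⟩ := h
    obtain ⟨t, ht, hvt⟩ := hv
    have hat : a * t ∈ QF.G φ := G_mul ha ht
    have hvat : ¬ ∃ s : K, s ≠ 0 ∧ O.valuation (a * t) = (O.valuation s) ^ 2 := by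
      rintro ⟨s', hs', h'⟩
      refine hvt ⟨s' / s, div_ne_zero hs' hs, ?_⟩
      have h0 : O.valuation s ^ 2 ≠ 0 := pow_ne_zero _ ((Valuation.ne_zero_iff _).2 hs)
      rw [map_div₀, div_pow, ← h', ← has, map_mul, mul_div_cancel_left₀]
      rwa [has]
    have h1 := (hyp2_mem O hres φ hφ hat hvat).1
    obtain ⟨h2, h3⟩ := hyp2_mem O hres φ hφ ht hvt
    have h4 := (QF.Hyp2 φ).mul_mem ((QF.Hyp2 φ).mul_mem h1 h2) (h3 t⁻¹ (inv_ne_zero ht.1))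
    have ht0 := ht.1
    have h5 : a * t * t * (t⁻¹ * t⁻¹) = a := by field_simp
    rwa [h5] at h4
  · exact (hyp2_mem O hres φ hφ ha h).1

theorem main (K : Type) [Field K] [Invertible (2 : K)] (O : ValuationSubring K)
    [HenselianLocalRing O] (hres : (2 : IsLocalRing.ResidueField O) ≠ 0)
    (φ : QF K) (hφ : φ.Nondeg)
    (hv : ∃ t ∈ QF.G φ, ¬ ∃ s : K, s ≠ 0 ∧ O.valuation t = (O.valuation s) ^ 2) :
    QF.G φ = QF.Hgrp φ ∧ QF.G φ = (QF.Hyp2 φ : Set K) := by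
  refine ⟨Set.Subset.antisymm ?_ ?_, Set.Subset.antisymm ?_ ?_⟩
  · intro a ha
    exact ⟨1, one_ne_zero, a, hyp2_sub φ (G_sub O hres φ hφ hv ha), by simp⟩
  · rintro _ ⟨s, hs, h, hh, rfl⟩
    rw [pow_two]
    exact G_mul (G_sq hs) (hyp_sub φ hφ hh)
  · intro a ha
    exact G_sub O hres φ hφ hv ha
  · intro a ha
    exact hyp_sub φ hφ (hyp2_sub φ ha)

end SM
/-- over a henselian valued field with residue characteristic ≠ 2,
if `v(G(φ)) ⊄ 2vK` then `G(φ) = H(φ) = Hyp₂(φ)`. -/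
theorem stmt11 (K : Type) [Field K] [Invertible (2 : K)] (O : ValuationSubring K)
    [HenselianLocalRing O] (hres : (2 : IsLocalRing.ResidueField O) ≠ 0)
    (φ : QF K) (hφ : φ.Nondeg)
    (hv : ∃ t ∈ QF.G φ, ¬ ∃ s : K, s ≠ 0 ∧ O.valuation t = (O.valuation s) ^ 2) :
    QF.G φ = QF.Hgrp φ ∧ QF.G φ = (QF.Hyp2 φ : Set K) := by
  exact SM.main K O hres φ hφ hv
end

section
/- Let k be a field of characteristic different from 2 and K = k((t)) the formal power series field, and let φ be a nondegenerate quadratic form over k which is not hyperbolic. Consider ρ = φ ⊥ tφ over K. Then G(ρ) = G(φ_K) ∪ t·G(φ_K) and G(φ_K) = K×²·G(φ). -/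
open scoped TensorProduct

/-- square roots of one-units -/
theorem ps_sqrt {k : Type} [Field k] [Invertible (2 : k)] (p : PowerSeries k)
    (hp : PowerSeries.constantCoeff p = 1) :
    ∃ s : PowerSeries k, s ^ 2 = p ∧ PowerSeries.constantCoeff s = 1 := by
  have h2 : (2 : k) ≠ 0 := Invertible.ne_zero 2
  have hH : HenselianRing (PowerSeries k) (Ideal.span {PowerSeries.X}) := inferInstance
  obtain ⟨s, hs, hs1⟩ := hH.is_henselian (Polynomial.X ^ 2 - Polynomial.C p)
    (Polynomial.monic_X_pow_sub_C _ (by norm_num)) 1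
    (by
      rw [Ideal.mem_span_singleton, PowerSeries.X_dvd_iff]
      simp [hp])
    (by
      refine IsUnit.map _ ?_
      rw [PowerSeries.isUnit_iff_constantCoeff]
      simp
      exact one_add_one_eq_two (R := k) ▸ h2)
  refine ⟨s, ?_, ?_⟩
  · simpa [Polynomial.IsRoot, sub_eq_zero] using hs
  · rw [Ideal.mem_span_singleton, PowerSeries.X_dvd_iff] at hs1
    simpa [sub_eq_zero] using hs1

theorem laurent_algebraMap {k : Type} [Field k] (c : k) :
    algebraMap k (LaurentSeries k) c = algebraMap (PowerSeries k) (LaurentSeries k) (PowerSeries.C c) := by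
  rw [LaurentSeries.coe_algebraMap, HahnSeries.ofPowerSeries_C, HahnSeries.algebraMap_apply']
  simp

theorem laurent_t {k : Type} [Field k] :
    (HahnSeries.single 1 1 : LaurentSeries k) = algebraMap (PowerSeries k) (LaurentSeries k) PowerSeries.X := by
  rw [LaurentSeries.coe_algebraMap]
  simp

theorem t_ne {k : Type} [Field k] : (HahnSeries.single 1 1 : LaurentSeries k) ≠ 0 := by
  simp

/-- square classes of Laurent series -/
theorem laurent_decomp {k : Type} [Field k] [Invertible (2 : k)] (x : LaurentSeries k) (hx : x ≠ 0) :
    ∃ s : LaurentSeries k, s ≠ 0 ∧ ∃ c : k, c ≠ 0 ∧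
      (x = s ^ 2 * algebraMap k (LaurentSeries k) c ∨
       x = HahnSeries.single 1 1 * (s ^ 2 * algebraMap k (LaurentSeries k) c)) := by
  set p := x.powerSeriesPart with hp
  have hxp := x.single_order_mul_powerSeriesPart
  set c := PowerSeries.constantCoeff p with hc
  have hc0 : c ≠ 0 := by
    rw [hc, hp, ← PowerSeries.coeff_zero_eq_constantCoeff_apply, LaurentSeries.powerSeriesPart_coeff]
    simpa using HahnSeries.coeff_order_eq_zero.not.mpr hx
  obtain ⟨s, hs, hs1⟩ := ps_sqrt (PowerSeries.C c⁻¹ * p) (by simp [← hc, hc0])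
  have hps : p = s ^ 2 * PowerSeries.C c := by
    rw [hs, mul_comm, ← mul_assoc, ← map_mul, mul_inv_cancel₀ hc0]; simp
  have hs0 : algebraMap (PowerSeries k) (LaurentSeries k) s ≠ 0 := by
    rw [Ne, FaithfulSMul.algebraMap_eq_zero_iff]
    rintro rfl; simp at hs1
  have hxx : x = (HahnSeries.single 1 1 : LaurentSeries k) ^ x.order *
     (algebraMap (PowerSeries k) (LaurentSeries k) s ^ 2 * algebraMap k (LaurentSeries k) c) := by
    rw [laurent_algebraMap, ← map_pow, ← map_mul, ← hps, LaurentSeries.coe_algebraMap,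
      ← RatFunc.single_zpow, hxp]
  have ht := t_ne (k := k)
  set t := (HahnSeries.single 1 1 : LaurentSeries k)
  rcases Int.even_or_odd' x.order with ⟨m, hm | hm⟩
  · refine ⟨t ^ m * algebraMap (PowerSeries k) (LaurentSeries k) s, mul_ne_zero (zpow_ne_zero _ ht) hs0, c, hc0, Or.inl ?_⟩
    rw [hm, mul_comm 2 m, zpow_mul] at hxx
    rw [hxx]; simp only [zpow_ofNat]; ring
  · refine ⟨t ^ m * algebraMap (PowerSeries k) (LaurentSeries k) s, mul_ne_zero (zpow_ne_zero _ ht) hs0, c, hc0, Or.inr ?_⟩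
    rw [hm, zpow_add₀ ht, mul_comm 2 m, zpow_mul] at hxx
    rw [hxx]; simp only [zpow_ofNat]; ring

/-- a nonzero vector can be scaled to a primitive one -/
theorem exists_primitive {k : Type} [Field k] {ι : Type} [Fintype ι] (u : ι → LaurentSeries k) (hu : u ≠ 0) :
    ∃ (s : LaurentSeries k) (p : ι → PowerSeries k),
      (∀ i, s * u i = algebraMap (PowerSeries k) (LaurentSeries k) (p i)) ∧
      ∃ i, PowerSeries.constantCoeff (p i) ≠ 0 := by
  classical
  obtain ⟨⟨b, hb⟩, hb'⟩ := IsLocalization.exist_integer_multiples_of_finite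
    (nonZeroDivisors (PowerSeries k)) u
  choose p hp using hb'
  obtain ⟨i1, hi1⟩ := Function.ne_iff.mp hu
  have hbK : algebraMap (PowerSeries k) (LaurentSeries k) b ≠ 0 := by
    rw [Ne, FaithfulSMul.algebraMap_eq_zero_iff]
    exact nonZeroDivisors.ne_zero hb
  have hp' : ∀ i, algebraMap (PowerSeries k) (LaurentSeries k) (p i) =
      algebraMap (PowerSeries k) (LaurentSeries k) b * u i := fun i => by
    rw [hp i, Algebra.smul_def]
  have hpi1 : p i1 ≠ 0 := by
    intro h
    have := hp' i1
    rw [h, map_zero] at this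
    exact mul_ne_zero hbK hi1 this.symm
  have : Nonempty ι := ⟨i1⟩
  obtain ⟨i0, hmin⟩ := Finite.exists_min (fun i => (p i).order)
  have hpi0 : p i0 ≠ 0 := by
    intro h
    have := hmin i1
    rw [h, PowerSeries.order_zero, top_le_iff, PowerSeries.order_eq_top] at this
    exact hpi1 this
  set m := (p i0).order.toNat with hm
  have hmo : (m : ℕ∞) = (p i0).order := PowerSeries.coe_toNat_order hpi0
  have hdvd : ∀ i, PowerSeries.X ^ m ∣ p i := fun i => by
    rw [PowerSeries.X_pow_dvd_iff]
    intro j hj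
    apply PowerSeries.coeff_of_lt_order
    refine lt_of_lt_of_le ?_ (hmin i)
    rw [← hmo]; exact_mod_cast hj
  choose r hr using hdvd
  have hX : algebraMap (PowerSeries k) (LaurentSeries k) (PowerSeries.X ^ m) ≠ 0 := by
    rw [Ne, FaithfulSMul.algebraMap_eq_zero_iff]
    exact pow_ne_zero _ PowerSeries.X_ne_zero
  refine ⟨(algebraMap (PowerSeries k) (LaurentSeries k) (PowerSeries.X ^ m))⁻¹ *
    algebraMap (PowerSeries k) (LaurentSeries k) b, r, fun i => ?_, i0, ?_⟩
  · rw [mul_assoc, ← hp' i, hr i, map_mul, inv_mul_cancel_left₀ hX]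
  · have := PowerSeries.coeff_order hpi0
    rw [← hm] at this
    intro h
    apply this
    rw [hr i0, PowerSeries.coeff_X_pow_mul', if_pos le_rfl]
    simpa using h

/-- totally isotropic subspaces have at most half the dimension -/
theorem isotropic_le {k V : Type} [Field k] [AddCommGroup V] [Module k V] [FiniteDimensional k V]
    (q : QuadraticForm k V) (hq : (QuadraticMap.polarBilin q).Nondegenerate) (R : Submodule k V)
    (hR : ∀ x ∈ R, q x = 0) : 2 * Module.finrank k R ≤ Module.finrank k V := by
  have h1 := LinearMap.BilinForm.finrank_orthogonal hq R
  have h2 : R ≤ LinearMap.BilinForm.orthogonal (QuadraticMap.polarBilin q) R := by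
    intro x hx y hy
    simp [QuadraticMap.polar, hR _ hx, hR _ hy, hR _ (R.add_mem hy hx)]
  have h3 := Submodule.finrank_mono h2
  have h4 := R.finrank_le
  omega

theorem wss_polar {k ι : Type} [Field k] [Fintype ι] (w : ι → k) (x y : ι → k) :
    QuadraticMap.polar (QuadraticMap.weightedSumSquares k w) x y = ∑ i, 2 * w i * x i * y i := by
  simp only [QuadraticMap.polar, QuadraticMap.weightedSumSquares_apply, ← Finset.sum_sub_distrib]
  refine Finset.sum_congr rfl fun i _ => ?_
  simp; ring

theorem wss_nondeg {k ι : Type} [Field k] [Invertible (2 : k)] [Fintype ι] (w : ι → k) (hw : ∀ i, w i ≠ 0) :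
    (QuadraticMap.polarBilin (QuadraticMap.weightedSumSquares k w)).Nondegenerate := by
  classical
  have h2 : (2 : k) ≠ 0 := Invertible.ne_zero 2
  constructor
  · intro x hx
    ext i
    have := hx (Pi.single i 1)
    rw [QuadraticMap.polarBilin_apply_apply, wss_polar] at this
    simpa [Pi.single_apply, hw, h2] using this
  · intro x hx
    ext i
    have := hx (Pi.single i 1)
    rw [QuadraticMap.polarBilin_apply_apply, wss_polar] at this
    simpa [Pi.single_apply, hw, h2] using this

/-- extension of an injective functional from a subspace -/
theorem exists_proj {k V : Type} [Field k] [AddCommGroup V] [Module k V] [FiniteDimensional k V]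
    (R : Submodule k V) : ∃ g : V →ₗ[k] (Fin (Module.finrank k R) → k), ∀ x ∈ R, g x = 0 → x = 0 := by
  obtain ⟨g, hg⟩ := LinearMap.exists_extend ((Module.finBasis k R).equivFun.toLinearMap)
  refine ⟨g, fun x hx h => ?_⟩
  have := LinearMap.congr_fun hg ⟨x, hx⟩
  simp only [LinearMap.comp_apply, Submodule.subtype_apply, h] at this
  have h2 := (LinearEquiv.map_eq_zero_iff _).mp this.symm
  simpa using h2

theorem proj_lift {k : Type} [Field k] {ι : Type} [Fintype ι] {d : ℕ} (g : (ι → k) →ₗ[k] (Fin d → k)) :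
    ∃ G : (ι → LaurentSeries k) →ₗ[LaurentSeries k] (Fin d → LaurentSeries k),
      ∀ p : ι → PowerSeries k,
        G (fun i => algebraMap (PowerSeries k) (LaurentSeries k) (p i)) = 0 →
        g (fun i => PowerSeries.constantCoeff (p i)) = 0 := by
  classical
  refine ⟨Matrix.toLin' ((LinearMap.toMatrix' g).map (algebraMap k (LaurentSeries k))), fun p hp => ?_⟩
  have hg : ∀ x, g x = Matrix.mulVec (LinearMap.toMatrix' g) x := fun x => by
    rw [← Matrix.toLin'_apply, Matrix.toLin'_toMatrix']
  rw [hg]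
  ext j
  have := congrFun hp j
  simp only [Matrix.toLin'_apply, Matrix.mulVec, dotProduct, Matrix.map_apply, laurent_algebraMap,
    ← map_mul, ← map_sum, Pi.zero_apply, FaithfulSMul.algebraMap_eq_zero_iff] at this
  have h2 := congrArg PowerSeries.constantCoeff this
  simpa [Matrix.mulVec, dotProduct] using h2

/-- the key reduction step in Springer's theorem -/
theorem springer_lagr {k : Type} [Field k] [Invertible (2 : k)] {ι κ : Type} [Fintype ι] [Fintype κ]
    (w : ι → k) (w' : κ → k) (hw : ∀ i, w i ≠ 0) (hw' : ∀ i, w' i ≠ 0)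
    (U : Submodule (LaurentSeries k) ((ι → LaurentSeries k) × (κ → LaurentSeries k)))
    (hU : ∀ u ∈ U, ∑ i, algebraMap k (LaurentSeries k) (w i) * (u.1 i * u.1 i) +
      HahnSeries.single 1 1 * ∑ j, algebraMap k (LaurentSeries k) (w' j) * (u.2 j * u.2 j) = 0)
    (hdim : 2 * Module.finrank (LaurentSeries k) U = Fintype.card ι + Fintype.card κ) :
    ∃ R : Submodule k (ι → k), (∀ x ∈ R, QuadraticMap.weightedSumSquares k w x = 0) ∧
      2 * Module.finrank k R = Fintype.card ι := by
  set am := algebraMap (PowerSeries k) (LaurentSeries k) with ham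
  have key : ∀ (p : ι → PowerSeries k) (r : κ → PowerSeries k),
      ((fun i => am (p i), fun j => am (r j)) : (ι → LaurentSeries k) × (κ → LaurentSeries k)) ∈ U →
      ∑ i, PowerSeries.C (w i) * (p i * p i) + PowerSeries.X * ∑ j, PowerSeries.C (w' j) * (r j * r j) = 0 := by
    intro p r h
    have := hU _ h
    simp only [laurent_algebraMap, laurent_t, ham, ← map_mul, ← map_sum, ← map_add,
      FaithfulSMul.algebraMap_eq_zero_iff] at this
    exact this
  let R₁ : Submodule k (ι → k) :=
    { carrier := {x | ∃ (p : ι → PowerSeries k) (r : κ → PowerSeries k),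
        ((fun i => am (p i), fun j => am (r j)) : (ι → LaurentSeries k) × (κ → LaurentSeries k)) ∈ U ∧
        x = fun i => PowerSeries.constantCoeff (p i)}
      zero_mem' := ⟨0, 0, by simp only [Pi.zero_apply, map_zero]; exact U.zero_mem, by ext; simp⟩
      add_mem' := by
        rintro x y ⟨p, r, h, rfl⟩ ⟨p', r', h', rfl⟩
        refine ⟨p + p', r + r', ?_, by ext; simp⟩
        convert U.add_mem h h' using 1
        ext <;> simp
      smul_mem' := by
        rintro c x ⟨p, r, h, rfl⟩
        refine ⟨fun i => PowerSeries.C c * p i, fun j => PowerSeries.C c * r j, ?_, by ext; simp⟩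
        convert U.smul_mem (am (PowerSeries.C c)) h using 1
        ext <;> simp }
  let R₂ : Submodule k (κ → k) :=
    { carrier := {x | ∃ (p : ι → PowerSeries k) (r : κ → PowerSeries k),
        ((fun i => am (p i), fun j => am (r j)) : (ι → LaurentSeries k) × (κ → LaurentSeries k)) ∈ U ∧
        (∀ i, PowerSeries.constantCoeff (p i) = 0) ∧
        x = fun i => PowerSeries.constantCoeff (r i)}
      zero_mem' := ⟨0, 0, by simp only [Pi.zero_apply, map_zero]; exact U.zero_mem, by simp, by ext; simp⟩
      add_mem' := by
        rintro x y ⟨p, r, h, hz, rfl⟩ ⟨p', r', h', hz', rfl⟩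
        refine ⟨p + p', r + r', ?_, by simp [hz, hz'], by ext; simp⟩
        convert U.add_mem h h' using 1
        ext <;> simp
      smul_mem' := by
        rintro c x ⟨p, r, h, hz, rfl⟩
        refine ⟨fun i => PowerSeries.C c * p i, fun j => PowerSeries.C c * r j, ?_, by simp [hz], by ext; simp⟩
        convert U.smul_mem (am (PowerSeries.C c)) h using 1
        ext <;> simp }
  have hR₁ : ∀ x ∈ R₁, QuadraticMap.weightedSumSquares k w x = 0 := by
    rintro x ⟨p, r, h, rfl⟩
    have := congrArg PowerSeries.constantCoeff (key p r h)
    simpa using this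
  have hR₂ : ∀ x ∈ R₂, QuadraticMap.weightedSumSquares k w' x = 0 := by
    rintro x ⟨p, r, h, hz, rfl⟩
    have hdvd : ∀ i, PowerSeries.X ∣ p i := fun i => PowerSeries.X_dvd_iff.mpr (hz i)
    choose p' hp' using hdvd
    have h1 := key p r h
    have h2 : (PowerSeries.X : PowerSeries k) * (PowerSeries.X * ∑ i, PowerSeries.C (w i) * (p' i * p' i) +
        ∑ j, PowerSeries.C (w' j) * (r j * r j)) = 0 := by
      rw [← h1, mul_add, Finset.mul_sum, Finset.mul_sum]
      congr 1
      refine Finset.sum_congr rfl fun i _ => ?_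
      rw [hp' i]; ring
    have h3 := (mul_eq_zero.mp h2).resolve_left PowerSeries.X_ne_zero
    have := congrArg PowerSeries.constantCoeff h3
    simpa using this
  obtain ⟨g₁, hg₁⟩ := exists_proj R₁
  obtain ⟨g₂, hg₂⟩ := exists_proj R₂
  obtain ⟨G₁, hG₁⟩ := proj_lift g₁
  obtain ⟨G₂, hG₂⟩ := proj_lift g₂
  have hle : Module.finrank (LaurentSeries k) U ≤ Module.finrank k R₁ + Module.finrank k R₂ := by
    have hinj : Function.Injective ((G₁.prodMap G₂).domRestrict U) := by
      rw [← LinearMap.ker_eq_bot, LinearMap.ker_eq_bot']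
      rintro ⟨u, hu⟩ h
      by_contra hne
      have hG : G₁ u.1 = 0 ∧ G₂ u.2 = 0 := by simpa using h
      have hu0 : Sum.elim u.1 u.2 ≠ 0 := by
        intro h0
        apply hne
        rw [Submodule.mk_eq_zero]
        ext i : 2
        · exact congrFun h0 (Sum.inl i)
        · exact congrFun h0 (Sum.inr i)
      obtain ⟨s, p, hp, i, hi⟩ := exists_primitive _ hu0
      have hmem : ((fun i => am (p (Sum.inl i)), fun j => am (p (Sum.inr j))) :
          (ι → LaurentSeries k) × (κ → LaurentSeries k)) ∈ U := by
        convert U.smul_mem s hu using 1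
        ext i : 2
        · exact (hp (Sum.inl i)).symm
        · exact (hp (Sum.inr i)).symm
      have e1 : (fun i => am (p (Sum.inl i))) = s • u.1 := by
        ext i : 1
        exact (hp (Sum.inl i)).symm
      have e2 : (fun i => am (p (Sum.inr i))) = s • u.2 := by
        ext i : 1
        exact (hp (Sum.inr i)).symm
      have z1 := hg₁ _ ⟨_, _, hmem, rfl⟩ (hG₁ (fun i => p (Sum.inl i)) (by
        rw [← ham, e1, map_smul, hG.1, smul_zero]))
      have z2 := hg₂ _ ⟨_, _, hmem, fun i => congrFun z1 i, rfl⟩ (hG₂ (fun i => p (Sum.inr i)) (by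
        rw [← ham, e2, map_smul, hG.2, smul_zero]))
      rcases i with i | i
      · exact hi (congrFun z1 i)
      · exact hi (congrFun z2 i)
    have := LinearMap.finrank_le_finrank_of_injective hinj
    simpa using this
  have b1 := isotropic_le _ (wss_nondeg w hw) R₁ hR₁
  have b2 := isotropic_le _ (wss_nondeg w' hw') R₂ hR₂
  simp only [Module.finrank_fintype_fun_eq_card] at b1 b2
  exact ⟨R₁, hR₁, by omega⟩

/-- an isometric linear map out of a nondegenerate space, with equal dimensions, is an equivalence -/
theorem equiv_of_isom {k V W : Type} [Field k] [AddCommGroup V] [Module k V] [FiniteDimensional k V]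
    [AddCommGroup W] [Module k W] [FiniteDimensional k W]
    (q : QuadraticForm k V) (q' : QuadraticForm k W) (hq : (QuadraticMap.polarBilin q).Nondegenerate)
    (f : V →ₗ[k] W) (hf : ∀ x, q' (f x) = q x) (hd : Module.finrank k V = Module.finrank k W) :
    QuadraticMap.Equivalent q q' := by
  have hinj : Function.Injective f := by
    rw [← LinearMap.ker_eq_bot, LinearMap.ker_eq_bot']
    intro x hx
    apply hq.1 x
    intro y
    simp [QuadraticMap.polar, ← hf, hx]
  exact ⟨{ LinearEquiv.ofInjectiveOfFinrankEq f hinj hd with map_app' := fun x => by simpa using hf x }⟩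

/-- a nondegenerate form with a Lagrangian is isometric to the dual product form -/
theorem lagr_dualProd {k V : Type} [Field k] [Invertible (2 : k)] [AddCommGroup V] [Module k V]
    [FiniteDimensional k V] (q : QuadraticForm k V) (hq : (QuadraticMap.polarBilin q).Nondegenerate)
    (R : Submodule k V) (hR : ∀ x ∈ R, q x = 0) (hd : 2 * Module.finrank k R = Module.finrank k V) :
    QuadraticMap.Equivalent q (QuadraticForm.dualProd k R) := by
  symm
  have hp : ∀ x ∈ R, ∀ y ∈ R, QuadraticMap.polar q x y = 0 := fun x hx y hy => by
    simp [QuadraticMap.polar, hR _ hx, hR _ hy, hR _ (R.add_mem hx hy)]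
  -- restriction map to the dual
  let P : V →ₗ[k] Module.Dual k R := (Submodule.dualRestrict R).comp (QuadraticMap.polarBilin q)
  have hP : ∀ v (r : R), P v r = QuadraticMap.polar q v r := fun v r => rfl
  have hPs : Function.Surjective P := by
    refine (Subspace.dualRestrict_surjective (W := R)).comp ?_
    have hinj : Function.Injective (QuadraticMap.polarBilin q) := by
      rw [← LinearMap.ker_eq_bot, LinearMap.ker_eq_bot']
      intro x hx
      exact hq.1 x fun y => by rw [hx]; rfl
    exact (LinearMap.injective_iff_surjective_of_finrank_eq_finrank
      (Subspace.dual_finrank_eq).symm).mp hinj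
  obtain ⟨s, hs⟩ := LinearMap.exists_rightInverse_of_surjective P (LinearMap.range_eq_top.mpr hPs)
  have hs' : ∀ (l : Module.Dual k R) (r : R), QuadraticMap.polar q (s l) r = l r := fun l r => by
    rw [← hP]; exact LinearMap.congr_fun (LinearMap.congr_fun hs l) r
  -- correction term
  let b : Module.Dual k R →ₗ[k] Module.Dual k (Module.Dual k R) :=
    (⅟2 : k) • (QuadraticMap.polarBilin q).compl₁₂ s s
  let g : Module.Dual k R →ₗ[k] R := (Module.evalEquiv k R).symm.toLinearMap.comp b
  have hg : ∀ l m : Module.Dual k R, m (g l) = ⅟2 * QuadraticMap.polar q (s l) (s m) := fun l m => by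
    simp [g, b]
  let s' : Module.Dual k R →ₗ[k] V := s - R.subtype.comp g
  have hqs : ∀ l, q (s' l) = 0 := fun l => by
    have h1 : s' l = s l + (-1 : k) • (g l : V) := by simp [s', sub_eq_add_neg]
    have h2 := hs' l (g l)
    rw [hg] at h2
    rw [h1, QuadraticMap.map_add q, QuadraticMap.polar_smul_right, QuadraticMap.map_smul, hR _ (g l).2, h2,
      QuadraticMap.polar_self]
    have h20 : (2 : k) ≠ 0 := Invertible.ne_zero 2
    simp
    field_simp
    ring
  have hps : ∀ (l : Module.Dual k R) (r : R), QuadraticMap.polar q (s' l) r = l r := fun l r => by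
    have h1 : s' l = s l + (-1 : k) • (g l : V) := by simp [s', sub_eq_add_neg]
    rw [h1, QuadraticMap.polar_add_left, QuadraticMap.polar_smul_left, hs', hp _ (g l).2 _ r.2]
    simp
  refine equiv_of_isom _ _ ?_ (s'.coprod R.subtype) ?_ ?_
  · constructor
    · rintro ⟨l, r⟩ h
      have h1 : ∀ m : Module.Dual k R, m r = 0 := fun m => by
        have := h (m, 0)
        simpa [QuadraticMap.polar] using this
      have h2 : r = 0 := (Module.forall_dual_apply_eq_zero_iff k r).mp h1
      subst h2
      have h3 : l = 0 := by
        ext r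
        have := h (0, r)
        simpa [QuadraticMap.polar] using this
      rw [h3]; rfl
    · rintro ⟨l, r⟩ h
      have h1 : ∀ m : Module.Dual k R, m r = 0 := fun m => by
        have := h (m, 0)
        simpa [QuadraticMap.polar] using this
      have h2 : r = 0 := (Module.forall_dual_apply_eq_zero_iff k r).mp h1
      subst h2
      have h3 : l = 0 := by
        ext r
        have := h (0, r)
        simpa [QuadraticMap.polar] using this
      rw [h3]; rfl
  · rintro ⟨l, r⟩
    rw [LinearMap.coprod_apply, QuadraticMap.map_add q, hqs]
    simp [hps, hR _ r.2]
  · rw [Module.finrank_prod, Subspace.dual_finrank_eq, ← hd]; ring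

theorem lagr_equiv {k V W : Type} [Field k] [Invertible (2 : k)] [AddCommGroup V] [Module k V]
    [FiniteDimensional k V] [AddCommGroup W] [Module k W]
    [FiniteDimensional k W] (q : QuadraticForm k V) (hq : (QuadraticMap.polarBilin q).Nondegenerate)
    (q' : QuadraticForm k W) (hq' : (QuadraticMap.polarBilin q').Nondegenerate)
    (R : Submodule k V) (hR : ∀ x ∈ R, q x = 0) (hd : 2 * Module.finrank k R = Module.finrank k V)
    (R' : Submodule k W) (hR' : ∀ x ∈ R', q' x = 0) (hd' : 2 * Module.finrank k R' = Module.finrank k W)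
    (hdd : Module.finrank k V = Module.finrank k W) :
    QuadraticMap.Equivalent q q' := by
  refine (lagr_dualProd q hq R hR hd).trans (QuadraticMap.Equivalent.trans ?_ (lagr_dualProd q' hq' R' hR' hd').symm)
  exact ⟨QuadraticForm.dualProdIsometry (LinearEquiv.ofFinrankEq R R' (by omega))⟩

theorem equiv_nondeg {k V W : Type} [Field k] [AddCommGroup V] [Module k V]
    [AddCommGroup W] [Module k W] (q : QuadraticForm k V) (q' : QuadraticForm k W)
    (hq : (QuadraticMap.polarBilin q).Nondegenerate) (h : QuadraticMap.Equivalent q q') :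
    (QuadraticMap.polarBilin q').Nondegenerate := by
  obtain ⟨f⟩ := h
  have hpol : ∀ x y, QuadraticMap.polar q' (f x) (f y) = QuadraticMap.polar q x y := fun x y => by
    simp [QuadraticMap.polar, ← map_add]
  constructor
  · intro x hx
    have : f.symm x = 0 := hq.1 _ fun y => by
      have := hx (f y)
      rw [QuadraticMap.polarBilin_apply_apply] at this ⊢
      rw [← hpol, f.apply_symm_apply, this]
    simpa using congrArg f this
  · intro x hx
    have : f.symm x = 0 := hq.2 _ fun y => by
      have := hx (f y)
      rw [QuadraticMap.polarBilin_apply_apply] at this ⊢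
      rw [← hpol, f.apply_symm_apply, this]
    simpa using congrArg f this

theorem prod_nondeg {k V W : Type} [Field k] [AddCommGroup V] [Module k V]
    [AddCommGroup W] [Module k W] (q : QuadraticForm k V) (q' : QuadraticForm k W)
    (hq : (QuadraticMap.polarBilin q).Nondegenerate) (hq' : (QuadraticMap.polarBilin q').Nondegenerate) :
    (QuadraticMap.polarBilin (q.prod q')).Nondegenerate := by
  constructor
  · rintro ⟨x, y⟩ h
    have h1 : x = 0 := hq.1 x fun z => by simpa [QuadraticMap.polar] using h (z, 0)
    have h2 : y = 0 := hq'.1 y fun z => by simpa [QuadraticMap.polar] using h (0, z)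
    rw [h1, h2]; rfl
  · rintro ⟨x, y⟩ h
    have h1 : x = 0 := hq.2 x fun z => by simpa [QuadraticMap.polar] using h (z, 0)
    have h2 : y = 0 := hq'.2 y fun z => by simpa [QuadraticMap.polar] using h (0, z)
    rw [h1, h2]; rfl

theorem smul_nondeg {k V : Type} [Field k] [AddCommGroup V] [Module k V] (q : QuadraticForm k V) (c : k) (hc : c ≠ 0)
    (hq : (QuadraticMap.polarBilin q).Nondegenerate) :
    (QuadraticMap.polarBilin (c • q)).Nondegenerate := by
  constructor
  · intro x h
    refine hq.1 x fun z => ?_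
    have := h z
    simp only [QuadraticMap.polarBilin_apply_apply, FunLike.coe_smul, QuadraticMap.polar_smul, smul_eq_mul,
      mul_eq_zero, hc, false_or] at this
    exact this
  · intro x h
    refine hq.2 x fun z => ?_
    have := h z
    simp only [QuadraticMap.polarBilin_apply_apply, FunLike.coe_smul, QuadraticMap.polar_smul, smul_eq_mul,
      mul_eq_zero, hc, false_or] at this
    exact this

/-- Witt cancellation of a one-dimensional form -/
theorem cancel_one {k V W : Type} [Field k] [Invertible (2 : k)] [AddCommGroup V] [Module k V]
    [FiniteDimensional k V] [AddCommGroup W] [Module k W] [FiniteDimensional k W]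
    (q : QuadraticForm k V) (q' : QuadraticForm k W) (hq : (QuadraticMap.polarBilin q).Nondegenerate)
    (a : k)
    (f : (k × V) ≃ₗ[k] (k × W))
    (hf : ∀ x, a * ((f x).1 * (f x).1) + q' (f x).2 = a * (x.1 * x.1) + q x.2) :
    QuadraticMap.Equivalent q q' := by
  have h2 : (2 : k) ≠ 0 := Invertible.ne_zero 2
  have hd : Module.finrank k V = Module.finrank k W := by
    have := f.finrank_eq
    simp only [Module.finrank_prod] at this
    omega
  -- reduce to first coordinate different from one
  have main : ∀ f : (k × V) →ₗ[k] (k × W),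
      (∀ x, a * ((f x).1 * (f x).1) + q' (f x).2 = a * (x.1 * x.1) + q x.2) →
      (f (1, 0)).1 ≠ 1 → QuadraticMap.Equivalent q q' := by
    intro f hf hs
    set s := (f (1, 0)).1 with hs_def
    set w := (f (1, 0)).2 with hw_def
    have hs1 : 1 - s ≠ 0 := sub_ne_zero.mpr (Ne.symm hs)
    let l : V →ₗ[k] k := (LinearMap.fst k k W).comp (f.comp (LinearMap.inr k k V))
    let h : V →ₗ[k] W := (LinearMap.snd k k W).comp (f.comp (LinearMap.inr k k V))
    have hl : ∀ v, (f (0, v)).1 = l v := fun v => rfl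
    have hh : ∀ v, (f (0, v)).2 = h v := fun v => rfl
    refine equiv_of_isom q q' hq (h + (l.smulRight ((1 - s)⁻¹ • w))) (fun v => ?_) hd
    have e1 := hf (0, v)
    have e2 := hf (1, 0)
    have e3 := hf (1, v)
    have e4 : f (1, v) = f (1, 0) + f (0, v) := by rw [← map_add]; simp
    rw [e4, Prod.fst_add, Prod.snd_add, QuadraticMap.map_add q'] at e3
    simp only [hl, hh, ← hs_def, ← hw_def, QuadraticMap.map_zero] at e1 e2 e3
    simp only [LinearMap.add_apply, LinearMap.smulRight_apply, smul_smul]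
    rw [QuadraticMap.map_add q', QuadraticMap.map_smul, QuadraticMap.polar_smul_right, QuadraticMap.polar_comm]
    simp only [smul_eq_mul]
    have e5 : QuadraticMap.polar q' w (h v) = - (2 * a * s * l v) := by linear_combination e3 - e1 - e2
    have e6 : q' w = a * (1 - s * s) := by linear_combination e2
    have e7 : q' (h v) = q v - a * (l v * l v) := by linear_combination e1
    rw [e5, e6, e7]
    field_simp
    ring
  by_cases hs : (f (1, 0)).1 = 1
  · refine main (-(f : (k × V) →ₗ[k] (k × W))) (fun x => ?_) ?_
    · simpa using hf x
    · simp only [LinearMap.neg_apply, LinearEquiv.coe_coe, Prod.fst_neg, hs]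
      intro h
      exact h2 (by linear_combination -h)
  · exact main f hf hs

/-- Witt cancellation of diagonal forms -/
theorem cancel_wss {k V W : Type} [Field k] [Invertible (2 : k)] [AddCommGroup V] [Module k V]
    [FiniteDimensional k V] [AddCommGroup W] [Module k W] [FiniteDimensional k W]
    (q : QuadraticForm k V) (q' : QuadraticForm k W) (hq : (QuadraticMap.polarBilin q).Nondegenerate)
    (n : ℕ) (w : Fin n → k) (hw : ∀ i, w i ≠ 0)
    (h : QuadraticMap.Equivalent (q.prod (QuadraticMap.weightedSumSquares k w))
      (q'.prod (QuadraticMap.weightedSumSquares k w))) :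
    QuadraticMap.Equivalent q q' := by
  induction n with
  | zero =>
    obtain ⟨f⟩ := h
    refine equiv_of_isom q q' hq ((LinearMap.fst _ _ _).comp (f.toLinearEquiv.toLinearMap.comp (LinearMap.inl _ _ _)))
      (fun x => ?_) ?_
    · have := f.map_app (x, 0)
      rw [QuadraticMap.prod_apply, QuadraticMap.prod_apply] at this
      simp only [QuadraticMap.weightedSumSquares_apply, Finset.univ_eq_empty, Finset.sum_empty, add_zero] at this
      exact this
    · simpa using f.toLinearEquiv.finrank_eq
  | succ n ih =>
    refine ih (fun i => w i.succ) (fun i => hw _) ?_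
    obtain ⟨f⟩ := h
    have split : ∀ (Z : Type) [AddCommGroup Z] [Module k Z] (r : QuadraticForm k Z),
        ∃ e : (k × (Z × (Fin n → k))) ≃ₗ[k] (Z × (Fin (n + 1) → k)),
        ∀ x, (r.prod (QuadraticMap.weightedSumSquares k w)) (e x) =
          w 0 * (x.1 * x.1) + (r.prod (QuadraticMap.weightedSumSquares k (fun i => w i.succ))) x.2 := by
      intro Z _ _ r
      refine ⟨
        { toFun := fun x => (x.2.1, Fin.cons x.1 x.2.2)
          invFun := fun y => (y.2 0, (y.1, fun i => y.2 i.succ))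
          map_add' := fun x y => by
            ext i
            · rfl
            · refine Fin.cases ?_ (fun i => ?_) i <;> simp
          map_smul' := fun c x => by
            ext i
            · rfl
            · refine Fin.cases ?_ (fun i => ?_) i <;> simp
          left_inv := fun x => by simp
          right_inv := fun y => by
            ext i
            · rfl
            · refine Fin.cases ?_ (fun i => ?_) i <;> simp }, fun x => ?_⟩
      simp [Fin.sum_univ_succ]
      ring
    obtain ⟨e1, he1⟩ := split V q
    obtain ⟨e2, he2⟩ := split W q'
    have hnd : (QuadraticMap.polarBilin (q.prod (QuadraticMap.weightedSumSquares k (fun i : Fin n => w i.succ)))).Nondegenerate :=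
      prod_nondeg _ _ hq (wss_nondeg _ fun i => hw _)
    refine cancel_one _ _ hnd (w 0) (e1.trans (f.toLinearEquiv.trans e2.symm)) (fun x => ?_)
    rw [← he1, ← he2]
    simp
theorem hyp_data {k : Type} [Field k] [Invertible (2 : k)] (m : ℕ) :
    (QuadraticMap.polarBilin (QF.hyperbolics (K := k) m).q).Nondegenerate ∧
    Module.finrank k (QF.hyperbolics (K := k) m).V = 2 * m ∧
    ∃ j : (Fin m → k) →ₗ[k] (QF.hyperbolics (K := k) m).V, Function.Injective j ∧
      ∀ x, (QF.hyperbolics (K := k) m).q (j x) = 0 := by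
  induction m with
  | zero =>
    refine ⟨wss_nondeg (ι := Fin 0) (fun _ => 1) (fun i => i.elim0), ?_, 0, ?_, ?_⟩
    · exact Module.finrank_fin_fun k
    · exact Function.injective_of_subsingleton _
    · intro x; simp
  | succ m ih =>
    obtain ⟨h1, h2, j, hj, hq⟩ := ih
    refine ⟨?_, ?_, ?_⟩
    · refine prod_nondeg _ _ (wss_nondeg ![(1 : k), -1] ?_) h1
      intro i; fin_cases i <;> simp
    · have : Module.finrank k ((Fin 2 → k) × (QF.hyperbolics (K := k) m).V) = 2 * (m + 1) := by
        rw [Module.finrank_prod, h2]; simp; ring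
      exact this
    · let j1 : (Fin (m + 1) → k) →ₗ[k] (Fin 2 → k) := LinearMap.pi fun _ => LinearMap.proj 0
      let j2 : (Fin (m + 1) → k) →ₗ[k] (Fin m → k) := LinearMap.pi fun i => LinearMap.proj i.succ
      refine ⟨j1.prod (j.comp j2), ?_, ?_⟩
      · intro x y hxy
        have e1 : j1 x = j1 y := congrArg Prod.fst hxy
        have e2 : j2 x = j2 y := hj (congrArg Prod.snd hxy)
        ext i
        refine Fin.cases ?_ (fun i => ?_) i
        · exact congrFun e1 0
        · exact congrFun e2 i
      · intro x
        have e : (QF.hyperbolics (K := k) (m + 1)).q ((j1.prod (j.comp j2)) x) =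
          QuadraticMap.weightedSumSquares k ![(1 : k), -1] (j1 x) + (QF.hyperbolics (K := k) m).q (j (j2 x)) := rfl
        refine e.trans ?_
        rw [hq]
        simp [j1]

theorem lagr_hyperbolic {k : Type} [Field k] [Invertible (2 : k)] (φ : QF k) (hφ : φ.Nondeg)
    (R : Submodule k φ.V) (hR : ∀ x ∈ R, φ.q x = 0) (hd : 2 * Module.finrank k R = Module.finrank k φ.V) :
    φ.IsHyperbolic := by
  refine ⟨Module.finrank k R, ?_⟩
  obtain ⟨h1, h2, j, hj, hq⟩ := hyp_data (k := k) (Module.finrank k R)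
  have hr : Module.finrank k (LinearMap.range j) = Module.finrank k R := by
    rw [LinearMap.finrank_range_of_inj hj]; simp
  refine lagr_equiv φ.q hφ _ h1 R hR hd (LinearMap.range j) ?_ (by rw [hr, h2]) (by rw [h2, hd])
  rintro _ ⟨x, rfl⟩
  exact hq x

theorem exists_diag {k : Type} [Field k] [Invertible (2 : k)] (K : Type) [Field K] [Algebra k K]
    (φ : QF k) (hφ : φ.Nondeg) :
    ∃ (n : ℕ) (w : Fin n → k), (∀ i, w i ≠ 0) ∧
      QuadraticMap.Equivalent φ.q (QuadraticMap.weightedSumSquares k w) ∧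
      QuadraticMap.Equivalent (φ.baseChange K).q
        (QuadraticMap.weightedSumSquares K (fun i => algebraMap k K (w i))) := by
  letI : Invertible (2 : K) := (Invertible.map (algebraMap k K) 2).copy 2
    (map_ofNat (algebraMap k K) 2).symm
  obtain ⟨v, hv⟩ := LinearMap.BilinForm.exists_orthogonal_basis (QuadraticForm.associated_isSymm k φ.q)
  refine ⟨_, fun i => φ.q (v i), ?_, ⟨QuadraticForm.isometryEquivWeightedSumSquares φ.q v hv⟩, ?_⟩
  · intro i
    have hsep : (QuadraticMap.associated (R := k) φ.q).SeparatingLeft := by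
      intro x hx
      refine hφ.1 x fun y => ?_
      have := hx y
      rw [← QuadraticMap.two_nsmul_associated k]
      simp only [LinearMap.smul_apply, nsmul_eq_mul]
      exact mul_eq_zero_of_right _ this
    have := hv.not_isOrtho_basis_self_of_separatingLeft hsep i
    rwa [QuadraticMap.associated_eq_self_apply] at this
  · have ho : (QuadraticMap.associated (R := K) (φ.q.baseChange K)).IsOrthoᵢ (v.baseChange K) := by
      intro i j hij
      rw [QuadraticForm.associated_baseChange]
      have := hv hij
      simp [Function.onFun] at this ⊢
      simp [this]
    have := QuadraticMap.basisRepr_eq_of_iIsOrtho (φ.q.baseChange K) (v.baseChange K) ho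
    have e := QuadraticMap.isometryEquivBasisRepr (φ.q.baseChange K) (v.baseChange K)
    rw [this] at e
    have h3 : (fun i => (φ.q.baseChange K) ((v.baseChange K) i)) = fun i => algebraMap k K (φ.q (v i)) := by
      ext i
      rw [Module.Basis.baseChange_apply, QuadraticForm.baseChange_tmul]
      simp [Algebra.smul_def]
    rw [h3] at e
    exact ⟨e⟩

section Gfacts
variable {K : Type} [Field K]

theorem mem_G_of (φ : QF K) {a : K} (ha : a ≠ 0) (f : φ.V ≃ₗ[K] φ.V) (hf : ∀ x, φ.q (f x) = a * φ.q x) :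
    a ∈ QF.G φ := ⟨ha, ⟨{ f with map_app' := hf }⟩⟩

theorem of_mem_G {φ : QF K} {a : K} (ha : a ∈ QF.G φ) :
    ∃ f : φ.V ≃ₗ[K] φ.V, ∀ x, φ.q (f x) = a * φ.q x := by
  obtain ⟨_, ⟨f⟩⟩ := ha
  exact ⟨f.toLinearEquiv, f.map_app⟩

theorem G_mul (φ : QF K) {a b : K} (ha : a ∈ QF.G φ) (hb : b ∈ QF.G φ) : a * b ∈ QF.G φ := by
  obtain ⟨f, hf⟩ := of_mem_G ha
  obtain ⟨g, hg⟩ := of_mem_G hb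
  refine mem_G_of φ (mul_ne_zero ha.1 hb.1) (g.trans f) fun x => ?_
  rw [LinearEquiv.trans_apply, hf, hg, mul_assoc]

theorem G_sq (φ : QF K) {s : K} (hs : s ≠ 0) : s ^ 2 ∈ QF.G φ := by
  refine mem_G_of φ (pow_ne_zero _ hs) (LinearEquiv.smulOfNeZero K φ.V s hs) fun x => ?_
  change φ.q (s • x) = s ^ 2 * φ.q x
  rw [QuadraticMap.map_smul]; simp [pow_two]

theorem G_cancel (φ : QF K) {a b : K} (ha : a ∈ QF.G φ) (hab : a * b ∈ QF.G φ) : b ∈ QF.G φ := by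
  have h := G_mul φ (G_mul φ ha hab) (G_sq φ (inv_ne_zero ha.1))
  have ha0 := ha.1
  convert h using 1
  field_simp

theorem G_baseChange [Invertible (2 : K)] (L : Type) [Field L] [Algebra K L] (φ : QF K) {c : K} (hc : c ∈ QF.G φ) :
    algebraMap K L c ∈ QF.G (φ.baseChange L) := by
  obtain ⟨f, hf⟩ := of_mem_G hc
  refine mem_G_of _ (by simpa using hc.1) (f.baseChange K L φ.V φ.V) ?_
  have : (φ.q.baseChange L).comp (f.baseChange K L φ.V φ.V).toLinearMap = algebraMap K L c • φ.q.baseChange L := by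
    apply baseChange_ext
    intro m
    simp [hf, Algebra.smul_def]
  intro x
  exact congrArg (fun Q : QuadraticForm L (L ⊗[K] φ.V) => Q x) this

theorem G_add (φ : QF K) (t : K) {a : K} (ha : a ∈ QF.G φ) : a ∈ QF.G (QF.add φ (QF.smul t φ)) := by
  obtain ⟨f, hf⟩ := of_mem_G ha
  refine mem_G_of _ ha.1 (show (φ.V × φ.V) ≃ₗ[K] (φ.V × φ.V) from LinearEquiv.prodCongr f f) ?_
  have key : ∀ x y : φ.V, φ.q (f x) + t * φ.q (f y) = a * (φ.q x + t * φ.q y) := by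
    intro x y
    rw [hf, hf]; ring
  exact fun z => key z.1 z.2

theorem G_add_t (φ : QF K) {t : K} (ht : t ≠ 0) : t ∈ QF.G (QF.add φ (QF.smul t φ)) := by
  refine mem_G_of _ ht (show (φ.V × φ.V) ≃ₗ[K] (φ.V × φ.V) from
    (LinearEquiv.prodComm K φ.V φ.V).trans
      (LinearEquiv.prodCongr (LinearEquiv.smulOfNeZero K φ.V t ht) (LinearEquiv.refl K φ.V))) ?_
  have key : ∀ x y : φ.V, φ.q (t • y) + t * φ.q x = t * (φ.q x + t * φ.q y) := by
    intro x y
    rw [QuadraticMap.map_smul]; simp only [smul_eq_mul]; ring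
  exact fun z => key z.1 z.2

end Gfacts

section final
variable {k : Type} [Field k] [Invertible (2 : k)]

theorem wss_eq {K : Type} [Field K] {ι : Type} [Fintype ι] (w x : ι → K) :
    QuadraticMap.weightedSumSquares K w x = ∑ i, w i * (x i * x i) := by
  simp [QuadraticMap.weightedSumSquares_apply]

theorem hyperbolic_of_lagr (φ : QF k) (hφ : φ.Nondeg) {n : ℕ} (w : Fin n → k)
    (e : QuadraticMap.Equivalent φ.q (QuadraticMap.weightedSumSquares k w))
    (R : Submodule k (Fin n → k)) (hR : ∀ x ∈ R, QuadraticMap.weightedSumSquares k w x = 0)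
    (hd : 2 * Module.finrank k R = n) : φ.IsHyperbolic := by
  let ψ : QF k := { V := Fin n → k, q := QuadraticMap.weightedSumSquares k w }
  have hψ : ψ.Nondeg := equiv_nondeg _ _ hφ e
  obtain ⟨m, hm⟩ := lagr_hyperbolic ψ hψ R hR
    (hd.trans (Module.finrank_fin_fun k).symm)
  exact ⟨m, QuadraticMap.Equivalent.trans e hm⟩

theorem t_notMem (φ : QF k) (hφ : φ.Nondeg) (hnh : ¬ φ.IsHyperbolic) :
    (HahnSeries.single 1 1 : LaurentSeries k) ∉ QF.G (φ.baseChange (LaurentSeries k)) := by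
  intro ht
  obtain ⟨n, w, hw, e, ⟨g⟩⟩ := exists_diag (LaurentSeries k) φ hφ
  obtain ⟨f, hf⟩ := of_mem_G ht
  let F : (Fin n → LaurentSeries k) →ₗ[LaurentSeries k] (Fin n → LaurentSeries k) :=
    (g.toLinearEquiv.symm.trans (f.trans g.toLinearEquiv)).toLinearMap
  have hF : ∀ x, QuadraticMap.weightedSumSquares (LaurentSeries k)
      (fun i => algebraMap k (LaurentSeries k) (w i)) (F x) =
      HahnSeries.single 1 1 * QuadraticMap.weightedSumSquares (LaurentSeries k)
      (fun i => algebraMap k (LaurentSeries k) (w i)) x := by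
    intro x
    have h1 := g.map_app (f (g.toLinearEquiv.symm x))
    have h2 := g.map_app (g.toLinearEquiv.symm x)
    have h3 : g.toFun (g.toLinearEquiv.symm x) = x := g.toLinearEquiv.apply_symm_apply x
    refine h1.trans ((hf _).trans ?_)
    rw [← h2]
    exact congrArg _ (congrArg _ h3)
  have hinj : Function.Injective (F.prod LinearMap.id) := fun x y h => congrArg Prod.snd h
  obtain ⟨R, hR, hd⟩ := springer_lagr w (fun i => - w i) hw (fun i => neg_ne_zero.2 (hw i))
    (LinearMap.range (F.prod LinearMap.id)) (by
      rintro _ ⟨x, rfl⟩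
      have := hF x
      rw [wss_eq, wss_eq] at this
      simp only [LinearMap.prod_apply, Function.prod_apply, LinearMap.id_coe, id_eq, map_neg, neg_mul,
        Finset.sum_neg_distrib, mul_neg]
      rw [this, add_neg_cancel]) (by
      rw [LinearMap.finrank_range_of_inj hinj]; simp; ring)
  exact hnh (hyperbolic_of_lagr φ hφ w e R hR (by simpa using hd))

theorem c_mem (φ : QF k) (hφ : φ.Nondeg) {c : k} (hc0 : c ≠ 0)
    (hc : algebraMap k (LaurentSeries k) c ∈ QF.G (QF.add (φ.baseChange (LaurentSeries k))
      (QF.smul (HahnSeries.single 1 1 : LaurentSeries k) (φ.baseChange (LaurentSeries k))))) :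
    c ∈ QF.G φ := by
  obtain ⟨n, w, hw, e, ⟨g⟩⟩ := exists_diag (LaurentSeries k) φ hφ
  obtain ⟨f, hf⟩ := of_mem_G hc
  set W := QuadraticMap.weightedSumSquares (LaurentSeries k)
      (fun i => algebraMap k (LaurentSeries k) (w i)) with hW
  let g2 : ((φ.baseChange (LaurentSeries k)).V × (φ.baseChange (LaurentSeries k)).V) ≃ₗ[LaurentSeries k]
    ((Fin n → LaurentSeries k) × (Fin n → LaurentSeries k)) :=
    LinearEquiv.prodCongr g.toLinearEquiv g.toLinearEquiv
  let f' : ((φ.baseChange (LaurentSeries k)).V × (φ.baseChange (LaurentSeries k)).V) ≃ₗ[LaurentSeries k]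
    ((φ.baseChange (LaurentSeries k)).V × (φ.baseChange (LaurentSeries k)).V) := f
  have hf' : ∀ z, (φ.baseChange (LaurentSeries k)).q (f' z).1 + HahnSeries.single 1 1 *
      (φ.baseChange (LaurentSeries k)).q (f' z).2 = algebraMap k (LaurentSeries k) c *
      ((φ.baseChange (LaurentSeries k)).q z.1 + HahnSeries.single 1 1 *
      (φ.baseChange (LaurentSeries k)).q z.2) := hf
  let F : ((Fin n → LaurentSeries k) × (Fin n → LaurentSeries k)) →ₗ[LaurentSeries k]
     ((Fin n → LaurentSeries k) × (Fin n → LaurentSeries k)) :=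
    (g2.symm.trans (f'.trans g2)).toLinearMap
  have hg : ∀ x, W (g.toLinearEquiv x) = (φ.baseChange (LaurentSeries k)).q x := g.map_app
  have hg' : ∀ x, (φ.baseChange (LaurentSeries k)).q (g.toLinearEquiv.symm x) = W x := by
    intro x
    rw [← hg, LinearEquiv.apply_symm_apply]
  have hF : ∀ z, W (F z).1 + HahnSeries.single 1 1 * W (F z).2 =
      algebraMap k (LaurentSeries k) c * (W z.1 + HahnSeries.single 1 1 * W z.2) := by
    intro z
    have h1 : W (F z).1 = (φ.baseChange (LaurentSeries k)).q (f' (g2.symm z)).1 := hg _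
    have h2 : W (F z).2 = (φ.baseChange (LaurentSeries k)).q (f' (g2.symm z)).2 := hg _
    rw [h1, h2, hf']
    have h3 : (φ.baseChange (LaurentSeries k)).q (g2.symm z).1 = W z.1 := hg' _
    have h4 : (φ.baseChange (LaurentSeries k)).q (g2.symm z).2 = W z.2 := hg' _
    rw [h3, h4]
  let S := (LinearEquiv.sumArrowLequivProdArrow (Fin n) (Fin n) (LaurentSeries k) (LaurentSeries k)).symm
  let H : ((Fin n → LaurentSeries k) × (Fin n → LaurentSeries k)) →ₗ[LaurentSeries k]
     ((Fin n ⊕ Fin n → LaurentSeries k) × (Fin n ⊕ Fin n → LaurentSeries k)) :=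
    (S.toLinearMap.comp ((LinearMap.fst _ _ _).prod ((LinearMap.fst _ _ _).comp F))).prod
    (S.toLinearMap.comp ((LinearMap.snd _ _ _).prod ((LinearMap.snd _ _ _).comp F)))
  have hH1 : ∀ z i, (H z).1 (Sum.inl i) = z.1 i := fun z i => rfl
  have hH2 : ∀ z i, (H z).2 (Sum.inl i) = z.2 i := fun z i => rfl
  have hH3 : ∀ z i, (H z).1 (Sum.inr i) = (F z).1 i := fun z i => rfl
  have hH4 : ∀ z i, (H z).2 (Sum.inr i) = (F z).2 i := fun z i => rfl
  have hinj : Function.Injective H := by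
    intro x y h
    refine Prod.ext ?_ ?_
    · funext i; rw [← hH1, ← hH1, h]
    · funext i; rw [← hH2, ← hH2, h]
  let u : Fin n ⊕ Fin n → k := Sum.elim (fun i => c * w i) (fun i => - w i)
  have hu : ∀ i, u i ≠ 0 := by
    rintro (i | i)
    · exact mul_ne_zero hc0 (hw i)
    · exact neg_ne_zero.2 (hw i)
  obtain ⟨R, hR, hd⟩ := springer_lagr u u hu hu (LinearMap.range H) (by
      rintro _ ⟨z, rfl⟩
      have := hF z
      rw [hW, wss_eq, wss_eq, wss_eq, wss_eq] at this
      simp only [Fintype.sum_sum_type, hH1, hH2, hH3, hH4, u, Sum.elim_inl, Sum.elim_inr, map_mul, map_neg,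
        neg_mul, Finset.sum_neg_distrib, mul_assoc, ← Finset.mul_sum]
      linear_combination -this) (by
      rw [LinearMap.finrank_range_of_inj hinj]; simp; ring)
  -- now over the residue field
  have hnd : (QuadraticMap.polarBilin (QuadraticMap.weightedSumSquares k w)).Nondegenerate := wss_nondeg w hw
  have hnd' := wss_nondeg (fun i => - w i) (fun i => neg_ne_zero.2 (hw i))
  let T := LinearEquiv.sumArrowLequivProdArrow (Fin n) (Fin n) k k
  have hT : ∀ x, ((c • QuadraticMap.weightedSumSquares k w).prod
      (QuadraticMap.weightedSumSquares k (fun i => - w i))) (T x) = QuadraticMap.weightedSumSquares k u x := by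
    intro x
    have : ((c • QuadraticMap.weightedSumSquares k w).prod
      (QuadraticMap.weightedSumSquares k (fun i => - w i))) (T x) =
      c * QuadraticMap.weightedSumSquares k w (fun i => x (Sum.inl i)) +
        QuadraticMap.weightedSumSquares k (fun i => - w i) (fun i => x (Sum.inr i)) := rfl
    rw [this, wss_eq, wss_eq, wss_eq, Fintype.sum_sum_type]
    simp only [u, Sum.elim_inl, Sum.elim_inr, mul_assoc, ← Finset.mul_sum]
  have hdiag : Function.Injective
      ((LinearMap.id : (Fin n → k) →ₗ[k] (Fin n → k)).prod LinearMap.id) := fun x y h => congrArg Prod.snd h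
  have hE := lagr_equiv ((c • QuadraticMap.weightedSumSquares k w).prod
      (QuadraticMap.weightedSumSquares k (fun i => - w i)))
      (prod_nondeg _ _ (smul_nondeg _ c hc0 hnd) hnd')
      ((QuadraticMap.weightedSumSquares k w).prod
      (QuadraticMap.weightedSumSquares k (fun i => - w i)))
      (prod_nondeg _ _ hnd hnd')
      (R.map T.toLinearMap) (by
        rintro _ ⟨x, hx, rfl⟩
        exact (hT x).trans (hR x hx))
      (by
        have := LinearEquiv.finrank_map_eq T R
        rw [LinearEquiv.coe_toLinearMap] at *
        rw [this, hd]; simp)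
      (LinearMap.range ((LinearMap.id : (Fin n → k) →ₗ[k] (Fin n → k)).prod LinearMap.id)) (by
        rintro _ ⟨x, rfl⟩
        have : ((QuadraticMap.weightedSumSquares k w).prod
          (QuadraticMap.weightedSumSquares k (fun i => - w i))) (x, x) = 0 := by
          rw [QuadraticMap.prod_apply, wss_eq, wss_eq]
          simp
        exact this)
      (by rw [LinearMap.finrank_range_of_inj hdiag]; simp; ring) rfl
  have hE2 := cancel_wss _ _ (smul_nondeg _ c hc0 hnd) n _ (fun i => neg_ne_zero.2 (hw i)) hE
  obtain ⟨a⟩ := hE2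
  obtain ⟨b⟩ := e
  refine mem_G_of φ hc0 (b.toLinearEquiv.trans (a.toLinearEquiv.trans b.toLinearEquiv.symm)) fun x => ?_
  have hb : ∀ x, QuadraticMap.weightedSumSquares k w (b.toLinearEquiv x) = φ.q x := b.map_app
  have ha : ∀ x, QuadraticMap.weightedSumSquares k w (a.toLinearEquiv x) =
    c * QuadraticMap.weightedSumSquares k w x := a.map_app
  rw [LinearEquiv.trans_apply, LinearEquiv.trans_apply, ← hb, LinearEquiv.apply_symm_apply, ha, hb]

end final

/-- over `K = k((t))`, for `ρ = φ ⊥ tφ` with `φ` non-hyperbolic over `k`,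
one has `G(ρ) = G(φ_K) ∪ t·G(φ_K)` and `G(φ_K) = K×²·G(φ)`. -/
theorem stmt13 (k : Type) [Field k] [Invertible (2 : k)]
    (φ : QF k) (hφ : φ.Nondeg) (hnh : ¬ φ.IsHyperbolic) :
    let K := LaurentSeries k
    let t : K := HahnSeries.single 1 1
    let φK := QF.baseChange K φ
    let ρ := QF.add φK (QF.smul t φK)
    QF.G ρ = QF.G φK ∪ {x : K | ∃ y ∈ QF.G φK, x = t * y} ∧
    QF.G φK = {x : K | ∃ s : K, s ≠ 0 ∧ ∃ c : k, c ∈ QF.G φ ∧ x = s ^ 2 * algebraMap k K c} := by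
  intro K t φK ρ
  have ht0 : t ≠ 0 := HahnSeries.single_ne_zero one_ne_zero
  have htρ : t ∈ QF.G ρ := G_add_t φK ht0
  have hS : ∀ (s : K) (c : k), s ≠ 0 → c ∈ QF.G φ → s ^ 2 * algebraMap k K c ∈ QF.G φK :=
    fun s c hs hc => G_mul φK (G_sq φK hs) (G_baseChange K φ hc)
  have claim : ∀ x ∈ QF.G ρ, ∃ s : K, s ≠ 0 ∧ ∃ c : k, c ∈ QF.G φ ∧
      (x = s ^ 2 * algebraMap k K c ∨ x = t * (s ^ 2 * algebraMap k K c)) := by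
    intro x hx
    obtain ⟨s, hs, c, hc, h⟩ := laurent_decomp x hx.1
    refine ⟨s, hs, c, ?_, h⟩
    rcases h with rfl | rfl
    · exact c_mem φ hφ hc (G_cancel ρ (G_sq ρ hs) hx)
    · exact c_mem φ hφ hc (G_cancel ρ (G_sq ρ hs) (G_cancel ρ htρ hx))
  refine ⟨Set.Subset.antisymm ?_ ?_, Set.Subset.antisymm ?_ ?_⟩
  · intro x hx
    obtain ⟨s, hs, c, hc, h | h⟩ := claim x hx
    · left
      rw [h]
      exact hS s c hs hc
    · right
      exact ⟨_, hS s c hs hc, h⟩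
  · rintro x (hx | ⟨y, hy, rfl⟩)
    · exact G_add φK t hx
    · exact G_mul ρ htρ (G_add φK t hy)
  · intro x hx
    obtain ⟨s, hs, c, hc, h | h⟩ := claim x (G_add φK t hx)
    · exact ⟨s, hs, c, hc, h⟩
    · exfalso
      rw [h, mul_comm] at hx
      exact t_notMem φ hφ hnh (G_cancel φK (hS s c hs hc) hx)
  · rintro x ⟨s, hs, c, hc, rfl⟩
    exact hS s c hs hc
end

section
/- Let r ∈ ℕ, a₁,…,aᵣ ∈ K× with [K(√a₁,…,√aᵣ):K] = 2^r, let M = K(√a₁,…,√aᵣ), and let φ = (⟨1,-a₁⟩,…,⟨1,-aᵣ⟩) be the tuple of binary forms. Then G(φ) = ∩_{i=1}^r N_{K(√aᵢ)/K}(K(√aᵢ)×), Hyp(φ) = Hyp₂(φ) = N_{M/K}(M×), and H(φ) = K×²·N_{M/K}(M×); consequently G(φ)/H(φ) ≅ Λ(M/K), where Λ(M/K) = Ñ_{M/K}/(K×²·N_{M/K}(M×)) and Ñ_{M/K} is the intersection of the norm groups of all quadratic subextensions of M/K. -/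
open scoped TensorProduct

namespace Stmt16

/-- nonzero values of the binary form `⟨1,-b⟩` -/
def D {K : Type} [Field K] (b : K) : Set K := {c | c ≠ 0 ∧ ∃ x y : K, c = x ^ 2 - b * y ^ 2}

section D
variable {K : Type} [Field K]

theorem D_swap (h2 : (2 : K) ≠ 0) {b c : K} (hb : b ≠ 0) (h : c ∈ D b) : b ∈ D c := by
  obtain ⟨hc, x, y, hxy⟩ := h
  refine ⟨hb, ?_⟩
  by_cases hy : y = 0
  · subst hy
    have hx : x ≠ 0 := by rintro rfl; apply hc; rw [hxy]; ring
    refine ⟨(b + 1) / 2, (b - 1) / (2 * x), ?_⟩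
    rw [hxy]
    field_simp
    ring
  · refine ⟨x / y, 1 / y, ?_⟩
    rw [hxy]
    field_simp
    ring

theorem D_mul {b c d : K} (h : c ∈ D b) (h' : d ∈ D b) : c * d ∈ D b := by
  obtain ⟨hc, x, y, hxy⟩ := h
  obtain ⟨hd, u, v, huv⟩ := h'
  exact ⟨mul_ne_zero hc hd, x * u + b * y * v, x * v + y * u, by rw [hxy, huv]; ring⟩

theorem D_sq {b k : K} (hk : k ≠ 0) : k ^ 2 ∈ D b := ⟨pow_ne_zero 2 hk, k, 0, by ring⟩

theorem D_prod (h2 : (2 : K) ≠ 0) {ι : Type} (T : Finset ι) (a : ι → K) (ha : ∀ i, a i ≠ 0)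
    {c k : K} (hk : k ≠ 0) (hc0 : c ≠ 0) (hc : ∀ i ∈ T, c ∈ D (a i)) :
    c ∈ D (k ^ 2 * ∏ i ∈ T, a i) := by
  classical
  refine D_swap h2 hc0 ?_
  induction T using Finset.induction_on with
  | empty => simpa using D_sq hk
  | insert i T hi ih =>
    rw [Finset.prod_insert hi]
    have := D_mul (D_swap h2 (ha i) (hc i (Finset.mem_insert_self _ _)))
      (ih fun j hj => hc j (Finset.mem_insert_of_mem hj))
    convert this using 1
    ring

theorem bin_apply (b : K) (v : Fin 2 → K) : (QF.bin b).q v = v 0 ^ 2 - b * v 1 ^ 2 := by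
  refine (QuadraticMap.weightedSumSquares_apply ![(1 : K), -b] v).trans ?_
  simp [Fin.sum_univ_two]
  ring

theorem G_bin (b : K) : QF.G (QF.bin b) = D b := by
  ext c
  constructor
  · rintro ⟨hc, ⟨e⟩⟩
    refine ⟨hc, ?_⟩
    let v : Fin 2 → K := e (show Fin 2 → K from ![1, 0])
    refine ⟨v 0, v 1, ?_⟩
    rw [← bin_apply]
    have := e.map_app (show Fin 2 → K from ![1, 0])
    refine Eq.trans ?_ this.symm
    change c = c • (QF.bin b).q (show Fin 2 → K from ![1, 0])
    rw [bin_apply]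
    simp
  · rintro ⟨hc, x, y, hxy⟩
    refine ⟨hc, ?_⟩
    let f : (Fin 2 → K) →ₗ[K] (Fin 2 → K) := Matrix.toLin' !![x, b * y; y, x]
    let g : (Fin 2 → K) →ₗ[K] (Fin 2 → K) := Matrix.toLin' (c⁻¹ • !![x, -(b * y); -y, x])
    have hfg : f ∘ₗ g = LinearMap.id := by
      rw [← Matrix.toLin'_mul, ← Matrix.toLin'_one]
      congr 1
      ext i j
      fin_cases i <;> fin_cases j <;> simp [Matrix.mul_apply, Fin.sum_univ_two] <;> field_simp <;> rw [hxy] <;> ring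
    have hgf : g ∘ₗ f = LinearMap.id := by
      rw [← Matrix.toLin'_mul, ← Matrix.toLin'_one]
      congr 1
      ext i j
      fin_cases i <;> fin_cases j <;> simp [Matrix.mul_apply, Fin.sum_univ_two] <;> field_simp <;> rw [hxy] <;> ring
    let fe : (Fin 2 → K) ≃ₗ[K] (Fin 2 → K) := LinearEquiv.ofLinearMap f g hfg hgf
    refine ⟨{ fe with map_app' := ?_ }⟩
    intro (v : Fin 2 → K)
    change (QF.bin b).q (f v) = c • (QF.bin b).q v
    rw [bin_apply b v, bin_apply b (f v)]
    simp [f, Matrix.mulVec, dotProduct, Fin.sum_univ_two, hxy]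
    ring

end D

section quad
variable {K : Type} [Field K] {E : Type} [Field E] [Algebra K E]

theorem exists_coords (hE : Module.finrank K E = 2) (t : E)
    (ht : t ∉ Set.range (algebraMap K E)) :
    ∃ B : Module.Basis (Fin 2) K E, B 0 = 1 ∧ B 1 = t := by
  have hli : LinearIndependent K ![(1 : E), t] := by
    rw [LinearIndependent.pair_iff]
    intro x y hxy
    have hy : y = 0 := by
      by_contra hy
      apply ht
      refine ⟨-x / y, ?_⟩
      have hy' : algebraMap K E y ≠ 0 := by simpa using hy
      simp only [Algebra.smul_def] at hxy
      simp only [map_div₀, map_neg]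
      rw [div_eq_iff hy']
      linear_combination -hxy
    subst hy
    refine ⟨?_, rfl⟩
    simpa [Algebra.smul_def] using hxy
  refine ⟨basisOfLinearIndependentOfCardEqFinrank hli (by simp [hE]), ?_, ?_⟩ <;> simp

theorem norm_quad (hE : Module.finrank K E = 2) (t : E)
    (ht : t ∉ Set.range (algebraMap K E)) (b : K) (hb : t ^ 2 = algebraMap K E b) (x y : K) :
    Algebra.norm K (algebraMap K E x + algebraMap K E y * t) = x ^ 2 - b * y ^ 2 := by
  obtain ⟨B, hB0, hB1⟩ := exists_coords hE t ht
  rw [Algebra.norm_eq_matrix_det B, Matrix.det_fin_two]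
  have e0 : (algebraMap K E x + algebraMap K E y * t) * B 0 = x • B 0 + y • B 1 := by
    rw [hB0, hB1]; simp [Algebra.smul_def]
  have e1 : (algebraMap K E x + algebraMap K E y * t) * B 1 = (b * y) • B 0 + x • B 1 := by
    rw [hB0, hB1]; simp only [Algebra.smul_def, map_mul]
    linear_combination algebraMap K E y * hb
  simp only [Algebra.leftMulMatrix_eq_repr_mul, e0, e1]
  simp
  ring

theorem normSet_quad (hE : Module.finrank K E = 2) (t : E)
    (ht : t ∉ Set.range (algebraMap K E)) (b : K) (hb : t ^ 2 = algebraMap K E b) :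
    normSet K E = D b := by
  have : FiniteDimensional K E := Module.finite_of_finrank_eq_succ hE
  ext c
  constructor
  · rintro ⟨z, hz, rfl⟩
    refine ⟨(Algebra.norm_ne_zero_iff).2 hz, ?_⟩
    obtain ⟨B, hB0, hB1⟩ := exists_coords hE t ht
    have := B.sum_repr z
    rw [Fin.sum_univ_two, hB0, hB1, Algebra.smul_def, Algebra.smul_def, mul_one] at this
    refine ⟨B.repr z 0, B.repr z 1, ?_⟩
    rw [← norm_quad hE t ht b hb, this]
  · rintro ⟨hc, x, y, hxy⟩
    refine ⟨algebraMap K E x + algebraMap K E y * t, ?_, ?_⟩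
    · rw [← Algebra.norm_ne_zero_iff (R := K), norm_quad hE t ht b hb, ← hxy]; exact hc
    · rw [norm_quad hE t ht b hb, ← hxy]

theorem exists_sqrt (h2 : (2 : K) ≠ 0) (hE : Module.finrank K E = 2) :
    ∃ (t : E) (b : K), t ∉ Set.range (algebraMap K E) ∧ t ^ 2 = algebraMap K E b := by
  have : ∃ e : E, e ∉ Set.range (algebraMap K E) := by
    by_contra! h
    have : Module.finrank K E = 1 := by
      rw [finrank_eq_one_iff']
      refine ⟨1, one_ne_zero, fun w => ?_⟩
      obtain ⟨c, hc⟩ := h w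
      exact ⟨c, by rw [Algebra.smul_def, mul_one, hc]⟩
    omega
  obtain ⟨e, he⟩ := this
  obtain ⟨B, hB0, hB1⟩ := exists_coords hE e he
  have := B.sum_repr (e ^ 2)
  rw [Fin.sum_univ_two, hB0, hB1, Algebra.smul_def, Algebra.smul_def, mul_one] at this
  set p := B.repr (e ^ 2) 0
  set q := B.repr (e ^ 2) 1
  have h2' : (2 : E) ≠ 0 := by
    rw [← map_ofNat (algebraMap K E) 2]
    exact (map_ne_zero _).2 (h2)
  refine ⟨e - algebraMap K E (q / 2), p + (q / 2) ^ 2, ?_, ?_⟩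
  · rintro ⟨c, hc⟩
    exact he ⟨c + q / 2, by rw [map_add, hc]; ring⟩
  · simp only [map_add, map_pow, map_div₀, map_ofNat] at this ⊢
    field_simp
    linear_combination -4 * this

end quad

section tower
variable {K : Type} [Field K] {M : Type} [Field M] [Algebra K M] [FiniteDimensional K M]
  {r : ℕ} (s : Fin r → M) (a : Fin r → K)

/-- the subfield generated by some of the square roots -/
def F (T : Finset (Fin r)) : IntermediateField K M := IntermediateField.adjoin K (s '' T)

theorem mem_F_insert (hs : ∀ i, s i ^ 2 = algebraMap K M (a i)) (T : Finset (Fin r)) (i : Fin r)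
    (t : M) (ht : t ∈ F (K := K) s (insert i T)) :
    ∃ x ∈ F (K := K) s T, ∃ y ∈ F (K := K) s T, t = x + y * s i := by
  have h1 : t ∈ (F (K := K) s (insert i T)).toSubalgebra := ht
  rw [F, IntermediateField.adjoin_toSubalgebra] at h1
  induction h1 using Algebra.adjoin_induction with
  | mem x hx =>
    obtain ⟨j, hj, rfl⟩ := hx
    rcases Finset.mem_insert.1 (Finset.mem_coe.1 hj) with rfl | hj
    · exact ⟨0, zero_mem _, 1, one_mem _, by ring⟩
    · exact ⟨s j, IntermediateField.subset_adjoin _ _ ⟨j, hj, rfl⟩, 0, zero_mem _, by ring⟩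
  | algebraMap c => exact ⟨_, IntermediateField.algebraMap_mem _ c, 0, zero_mem _, by ring⟩
  | add u v hu hv ihu ihv =>
    rw [← IntermediateField.adjoin_toSubalgebra] at hu hv
    obtain ⟨x, hx, y, hy, rfl⟩ := ihu hu
    obtain ⟨x', hx', y', hy', rfl⟩ := ihv hv
    exact ⟨x + x', add_mem hx hx', y + y', add_mem hy hy', by ring⟩
  | mul u v hu hv ihu ihv =>
    rw [← IntermediateField.adjoin_toSubalgebra] at hu hv
    obtain ⟨x, hx, y, hy, rfl⟩ := ihu hu
    obtain ⟨x', hx', y', hy', rfl⟩ := ihv hv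
    refine ⟨x * x' + y * y' * algebraMap K M (a i),
      add_mem (mul_mem hx hx') (mul_mem (mul_mem hy hy') (IntermediateField.algebraMap_mem _ _)),
      x * y' + y * x', add_mem (mul_mem hx hy') (mul_mem hy hx'), ?_⟩
    rw [← hs i]; ring

theorem kummer (h2 : (2 : K) ≠ 0) (ha : ∀ i, a i ≠ 0)
    (hs : ∀ i, s i ^ 2 = algebraMap K M (a i)) (S : Finset (Fin r)) :
    ∀ (t : M) (b : K), t ∈ F (K := K) s S → t ^ 2 = algebraMap K M b →
    ∃ (T : Finset (Fin r)) (k : K), t = algebraMap K M k * ∏ i ∈ T, s i := by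
  classical
  have h2' : (2 : M) ≠ 0 := by
    rw [← map_ofNat (algebraMap K M) 2]
    exact (map_ne_zero _).2 (h2)
  induction S using Finset.induction_on with
  | empty =>
    intro t b ht _
    simp only [F, Finset.coe_empty, Set.image_empty, IntermediateField.adjoin_empty,
      IntermediateField.mem_bot] at ht
    obtain ⟨k, hk⟩ := ht
    exact ⟨∅, k, by simp [hk]⟩
  | insert i S hi ih =>
    intro t b ht hb
    obtain ⟨x, hx, y, hy, rfl⟩ := mem_F_insert s a hs S i t ht
    have hsi : s i ≠ 0 := by
      intro h
      have := hs i
      rw [h] at this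
      apply ha i
      simpa using this.symm
    by_cases hsS : s i ∈ F (K := K) s S
    · exact ih _ b (add_mem hx (mul_mem hy hsS)) hb
    have hxy : 2 * x * y = 0 := by
      by_contra hne
      apply hsS
      have hm : (algebraMap K M b - x ^ 2 - y ^ 2 * algebraMap K M (a i)) / (2 * x * y) ∈
          F (K := K) s S := by
        refine div_mem (sub_mem (sub_mem (IntermediateField.algebraMap_mem _ _) (pow_mem hx 2))
          (mul_mem (pow_mem hy 2) (IntermediateField.algebraMap_mem _ _))) ?_
        exact mul_mem (mul_mem (by exact_mod_cast natCast_mem (F (K := K) s S) 2) hx) hy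
      convert hm using 1
      rw [eq_div_iff hne, ← hb, ← hs i]
      ring
    rcases mul_eq_zero.1 hxy with h | h
    · have hx0 : x = 0 := by simpa [h2'] using h
      subst hx0
      have hai : algebraMap K M (a i) ≠ 0 := by simpa using ha i
      obtain ⟨T, k, hT⟩ := ih y (b / a i) hy (by
        rw [map_div₀, eq_div_iff hai, ← hb, ← hs i]; ring)
      by_cases hiT : i ∈ T
      · refine ⟨T.erase i, k * a i, ?_⟩
        rw [hT, ← Finset.mul_prod_erase T s hiT, map_mul, ← hs i]; ring
      · refine ⟨insert i T, k, ?_⟩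
        rw [hT, Finset.prod_insert hiT]; ring
    · subst h
      exact ih _ b (by simpa using hx) (by simpa using hb)

theorem finrank_F_union_le (S T : Finset (Fin r)) :
    Module.finrank K (F (K := K) s (S ∪ T)) ≤
      Module.finrank K (F (K := K) s S) * Module.finrank K (F (K := K) s T) := by
  have : F (K := K) s (S ∪ T) = F s S ⊔ F s T := by
    rw [F, F, F, Finset.coe_union, Set.image_union, IntermediateField.adjoin_union]
  rw [this]
  exact IntermediateField.finrank_sup_le _ _

theorem finrank_F_single_le (hs : ∀ i, s i ^ 2 = algebraMap K M (a i)) (i : Fin r) :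
    Module.finrank K (F (K := K) s {i}) ≤ 2 := by
  rw [F, Finset.coe_singleton, Set.image_singleton,
    IntermediateField.adjoin.finrank (Algebra.IsIntegral.isIntegral _)]
  have hp : (Polynomial.X ^ 2 - Polynomial.C (a i) : Polynomial K) ≠ 0 :=
    Polynomial.X_pow_sub_C_ne_zero (by norm_num) _
  have := Polynomial.natDegree_le_of_dvd (minpoly.dvd K (s i)
    (p := (Polynomial.X ^ 2 - Polynomial.C (a i) : Polynomial K)) (by simp [hs])) hp
  rwa [Polynomial.natDegree_X_pow_sub_C] at this

theorem finrank_F_le (hs : ∀ i, s i ^ 2 = algebraMap K M (a i)) (S : Finset (Fin r)) :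
    Module.finrank K (F (K := K) s S) ≤ 2 ^ S.card := by
  classical
  induction S using Finset.induction_on with
  | empty =>
    rw [F, Finset.coe_empty, Set.image_empty, IntermediateField.adjoin_empty,
      IntermediateField.finrank_bot]
    simp
  | insert i S hi ih =>
    rw [Finset.card_insert_of_notMem hi, pow_succ', Finset.insert_eq]
    exact (finrank_F_union_le s _ _).trans (Nat.mul_le_mul (finrank_F_single_le s a hs i) ih)

theorem F_univ (hgen : Algebra.adjoin K (Set.range s) = ⊤) :
    F (K := K) s Finset.univ = ⊤ := by
  rw [F, Finset.coe_univ, Set.image_univ, IntermediateField.adjoin_eq_top_iff_of_isAlgebraic]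
  · exact hgen
  · exact fun x _ => Algebra.IsAlgebraic.isAlgebraic x

theorem finrank_F (hs : ∀ i, s i ^ 2 = algebraMap K M (a i))
    (hgen : Algebra.adjoin K (Set.range s) = ⊤) (hdeg : Module.finrank K M = 2 ^ r)
    (S : Finset (Fin r)) : Module.finrank K (F (K := K) s S) = 2 ^ S.card := by
  classical
  refine le_antisymm (finrank_F_le s a hs S) ?_
  have h := finrank_F_union_le (K := K) s S Sᶜ
  rw [Finset.union_compl, F_univ s hgen, IntermediateField.finrank_top', hdeg] at h
  have h3 := finrank_F_le s a hs Sᶜ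
  have h4 : S.card + Sᶜ.card = r := by simpa using Finset.card_add_card_compl S
  have h5 : 2 ^ r = 2 ^ S.card * 2 ^ Sᶜ.card := by rw [← pow_add, h4]
  rw [h5] at h
  have := h.trans (Nat.mul_le_mul_left _ h3)
  exact Nat.le_of_mul_le_mul_right this (by positivity)

theorem isTwo (hs : ∀ i, s i ^ 2 = algebraMap K M (a i))
    (hgen : Algebra.adjoin K (Set.range s) = ⊤) (hdeg : Module.finrank K M = 2 ^ r) :
    IsTwoExtension K M := by
  classical
  refine ⟨inferInstance, r, fun i => F s (Finset.univ.filter fun j : Fin r => j.val < i.val),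
    ?_, ?_, ?_⟩
  · simp [F]
  · simp only [Fin.val_last, Fin.is_lt, Finset.filter_true]
    exact F_univ s hgen
  · intro i
    have hle : F (K := K) s (Finset.univ.filter fun j : Fin r => j.val < i.castSucc.val) ≤
        F s (Finset.univ.filter fun j : Fin r => j.val < i.succ.val) := by
      apply IntermediateField.adjoin.mono
      apply Set.image_mono
      intro j
      simp
      omega
    refine ⟨hle, ?_⟩
    have h := IntermediateField.finrank_bot_mul_relfinrank hle
    rw [finrank_F s a hs hgen hdeg, finrank_F s a hs hgen hdeg] at h
    have e : (Finset.univ.filter fun j : Fin r => j.val < i.succ.val) =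
        insert i (Finset.univ.filter fun j : Fin r => j.val < i.castSucc.val) := by
      ext j
      simp [Fin.ext_iff]
      omega
    rw [e, Finset.card_insert_of_notMem (by simp), pow_succ] at h
    beta_reduce
    rw [e]
    exact mul_left_cancel₀ (pow_ne_zero _ two_ne_zero) h

end tower

section hyp
variable {K : Type} [Field K] [Invertible (2 : K)] (L : Type) [Field L] [Algebra K L]

theorem baseChange_bin (b : K) :
    (QF.baseChange L (QF.bin b)).Equiv (QF.bin (algebraMap K L b)) := by
  have : Invertible (2 : L) := by
    have := Invertible.map (algebraMap K L) (2 : K)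
    exact this.copy 2 (map_ofNat (algebraMap K L) 2).symm
  let e : L ⊗[K] (Fin 2 → K) ≃ₗ[L] (Fin 2 → L) := TensorProduct.piScalarRight K L L (Fin 2)
  refine ⟨{ e with map_app' := ?_ }⟩
  have key : (QF.bin (algebraMap K L b)).q.comp e.toLinearMap =
      QuadraticForm.baseChange L (QF.bin b).q := by
    apply _root_.baseChange_ext
    intro m
    have he : e (1 ⊗ₜ m) = fun j => m j • (1 : L) := TensorProduct.piScalarRight_apply K L L (Fin 2) _
    have hm : (QF.bin b).q m = m 0 ^ 2 - b * m 1 ^ 2 := bin_apply b m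
    have h1 : (QF.bin (algebraMap K L b)).q (e (1 ⊗ₜ m)) =
        (m 0 ^ 2 - b * m 1 ^ 2) • ((1 : L) * 1) := by
      rw [bin_apply, he]
      simp [Algebra.smul_def]
    refine h1.trans ?_
    rw [← hm]
    exact (QuadraticForm.baseChange_tmul (A := L) (QF.bin b).q 1 m).symm
  intro v
  exact congrArg (fun q => q v) key

theorem isHyp_iff (b : K) (hb : b ≠ 0) :
    (QF.baseChange L (QF.bin b)).IsHyperbolic ↔ ∃ x : L, x ^ 2 = algebraMap K L b := by
  have h2 : (2 : L) ≠ 0 := by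
    rw [← map_ofNat (algebraMap K L) 2]
    exact (map_ne_zero _).2 (Invertible.ne_zero (2 : K))
  constructor
  · rintro ⟨m, hm⟩
    obtain ⟨e⟩ : QuadraticMap.Equivalent (QF.bin (algebraMap K L b)).q (QF.hyperbolics m : QF L).q :=
      (baseChange_bin L b).symm.trans hm
    cases m with
    | zero =>
      exfalso
      have h : (![1, 0] : Fin 2 → L) = 0 := by
        apply e.injective
        exact Subsingleton.elim (α := Fin 0 → L) _ _
      have := congrFun h 0
      simp at this
    | succ m =>
      let w : (QF.hyperbolics (m + 1) : QF L).V := ((![1, 1] : Fin 2 → L), (0 : (QF.hyperbolics m : QF L).V))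
      have hw : (QF.hyperbolics (m + 1) : QF L).q w = 0 := by
        change (QF.bin (1 : L)).q (![1, 1] : Fin 2 → L) + (QF.hyperbolics m : QF L).q 0 = 0
        rw [bin_apply]
        simp
      have hw0 : w ≠ 0 := by
        intro h
        have h1 : (![1, 1] : Fin 2 → L) = 0 := congrArg Prod.fst h
        have := congrFun h1 0
        simp at this
      let v : Fin 2 → L := e.symm w
      have hv : (QF.bin (algebraMap K L b)).q v = 0 := (e.symm.map_app w).trans hw
      have hv0 : v ≠ 0 := fun h => hw0 (e.symm.injective (h.trans (map_zero e.symm.toLinearEquiv).symm))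
      rw [bin_apply] at hv
      have hy : v 1 ≠ 0 := by
        intro h
        rw [h] at hv
        apply hv0
        ext i
        fin_cases i
        · simpa using hv
        · exact h
      refine ⟨v 0 / v 1, ?_⟩
      field_simp
      linear_combination hv
  · rintro ⟨x, hx⟩
    have hx0 : x ≠ 0 := by
      rintro rfl
      apply hb
      simpa using hx.symm
    refine ⟨1, (baseChange_bin L b).trans ?_⟩
    let f : (Fin 2 → L) ≃ₗ[L] (Fin 2 → L) × (Fin 0 → L) :=
      { toFun := fun v => (![v 0, x * v 1], 0)
        invFun := fun w => ![w.1 0, x⁻¹ * w.1 1]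
        map_add' := by
          intro u v
          ext i
          · fin_cases i <;> simp
            ring
          · exact i.elim0
        map_smul' := by
          intro c v
          ext i
          · fin_cases i <;> simp
            ring
          · exact i.elim0
        left_inv := by
          intro v
          ext i
          fin_cases i <;> simp [hx0]
        right_inv := by
          intro w
          ext i
          · fin_cases i <;> simp [hx0]
          · exact i.elim0 }
    refine ⟨{ f with map_app' := ?_ }⟩
    intro (v : Fin 2 → L)
    change (QF.bin (1 : L)).q (![v 0, x * v 1] : Fin 2 → L) + (QF.zero : QF L).q 0 =
      (QF.bin (algebraMap K L b)).q v
    rw [bin_apply (algebraMap K L b) v, bin_apply, ← hx, QuadraticMap.map_zero]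
    simp
    ring

end hyp

theorem norm_sub {K : Type} [Field K] {M : Type} [Field M] [Algebra K M] [FiniteDimensional K M]
    {r : ℕ} (s : Fin r → M) (a : Fin r → K) (hs : ∀ i, s i ^ 2 = algebraMap K M (a i))
    (hgen : Algebra.adjoin K (Set.range s) = ⊤)
    (L : Type) [Field L] [Algebra K L] [FiniteDimensional K L]
    (h : ∀ i, ∃ x : L, x ^ 2 = algebraMap K L (a i)) : normSet K L ⊆ normSet K M := by
  have hS : IntermediateField.adjoin K (Set.range s) = ⊤ := by
    rw [IntermediateField.adjoin_eq_top_iff_of_isAlgebraic]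
    · exact hgen
    · exact fun x _ => Algebra.IsAlgebraic.isAlgebraic x
  obtain ⟨f⟩ : Nonempty (M →ₐ[K] L) := by
    refine IntermediateField.nonempty_algHom_of_adjoin_splits (S := Set.range s) ?_ hS
    rintro _ ⟨i, rfl⟩
    refine ⟨Algebra.IsIntegral.isIntegral _, ?_⟩
    obtain ⟨x, hx⟩ := h i
    have hp : (Polynomial.X ^ 2 - Polynomial.C (a i) : Polynomial K) ≠ 0 :=
      Polynomial.X_pow_sub_C_ne_zero (by norm_num) _
    have hd := minpoly.dvd K (s i)
      (p := (Polynomial.X ^ 2 - Polynomial.C (a i) : Polynomial K)) (by simp [hs])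
    refine Polynomial.Splits.of_dvd (g := (Polynomial.X ^ 2 - Polynomial.C (a i)).map (algebraMap K L)) ?_
      ((Polynomial.map_ne_zero_iff (algebraMap K L).injective).2 hp)
      (Polynomial.map_dvd (algebraMap K L) hd)
    have : (Polynomial.X ^ 2 - Polynomial.C (a i) : Polynomial K).map (algebraMap K L) =
        (Polynomial.X - Polynomial.C x) * (Polynomial.X + Polynomial.C x) := by
      simp only [Polynomial.map_sub, Polynomial.map_pow, Polynomial.map_X, Polynomial.map_C, ← hx,
        Polynomial.C_pow]
      ring
    rw [this]
    exact (Polynomial.Splits.X_sub_C x).mul (Polynomial.Splits.X_add_C x)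
  letI : Algebra M L := f.toRingHom.toAlgebra
  haveI : IsScalarTower K M L := IsScalarTower.of_algebraMap_eq fun x => (f.commutes x).symm
  haveI : FiniteDimensional M L := FiniteDimensional.right K M L
  rintro _ ⟨z, hz, rfl⟩
  exact ⟨Algebra.norm M z, Algebra.norm_ne_zero_iff.2 hz, Algebra.norm_norm (S := M)⟩

/-- the norms as a submonoid -/
def normMon (K : Type) [Field K] (M : Type) [Field M] [Algebra K M] : Submonoid K where
  carrier := normSet K M
  one_mem' := ⟨1, one_ne_zero, map_one _⟩
  mul_mem' := by
    rintro _ _ ⟨x, hx, rfl⟩ ⟨y, hy, rfl⟩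
    exact ⟨x * y, mul_ne_zero hx hy, map_mul _ _ _⟩

end Stmt16
/-- for `M = K(√a₁,…,√aᵣ)` of degree `2^r` and the tuple
`φ = (⟨1,-a₁⟩,…,⟨1,-aᵣ⟩)`: `G(φ) = ∩ N_{K(√aᵢ)/K}`, `Hyp(φ) = Hyp₂(φ) = N_{M/K}`,
`H(φ) = K×²·N_{M/K}`, and consequently `G(φ) = Ñ_{M/K}` (so `G(φ)/H(φ) ≅ Λ(M/K)`). -/
theorem stmt16 (K : Type) [Field K] [Invertible (2 : K)] (r : ℕ)
    (a : Fin r → K) (ha : ∀ i, a i ≠ 0)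
    (M : Type) [Field M] [Algebra K M] [FiniteDimensional K M]
    (s : Fin r → M) (hs : ∀ i, s i ^ 2 = algebraMap K M (a i))
    (hgen : Algebra.adjoin K (Set.range s) = ⊤)
    (hdeg : Module.finrank K M = 2 ^ r) :
    QF.GT (fun i => QF.bin (a i))
        = ⋂ i : Fin r, normSet K (IntermediateField.adjoin K {s i}) ∧
    (QF.HypT (fun i => QF.bin (a i)) : Set K) = normSet K M ∧
    (QF.Hyp2T (fun i => QF.bin (a i)) : Set K) = normSet K M ∧
    QF.HgrpT (fun i => QF.bin (a i))
        = {x : K | ∃ c : K, c ≠ 0 ∧ ∃ y ∈ normSet K M, x = c ^ 2 * y} ∧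
    QF.GT (fun i => QF.bin (a i))
        = ⋂ (E : IntermediateField K M) (_ : Module.finrank K E = 2), normSet K E := by
  classical
  have h2 : (2 : K) ≠ 0 := Invertible.ne_zero 2
  have hG : ∀ i, QF.G (QF.bin (a i)) = normSet K (IntermediateField.adjoin K {s i}) := by
    intro i
    have hfr : Module.finrank K (IntermediateField.adjoin K {s i}) = 2 := by
      have := Stmt16.finrank_F s a hs hgen hdeg {i}
      rw [Stmt16.F, Finset.coe_singleton, Set.image_singleton] at this
      simpa using this
    rw [Stmt16.G_bin]
    refine (Stmt16.normSet_quad hfr (IntermediateField.AdjoinSimple.gen K (s i)) ?_ (a i) ?_).symm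
    · rintro ⟨c, hc⟩
      have hc' : algebraMap K M c = s i := congrArg Subtype.val hc
      have : IntermediateField.adjoin K {s i} = ⊥ := by
        rw [IntermediateField.adjoin_simple_eq_bot_iff, IntermediateField.mem_bot]
        exact ⟨c, hc'⟩
      rw [this, IntermediateField.finrank_bot] at hfr
      omega
    · apply Subtype.ext
      exact hs i
  have hfr1 : ∀ i, Module.finrank K (IntermediateField.adjoin K {s i}) = 2 := by
    intro i
    have := Stmt16.finrank_F s a hs hgen hdeg {i}
    rw [Stmt16.F, Finset.coe_singleton, Set.image_singleton] at this
    simpa using this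
  have hMhyp : ∀ i, QF.IsHyperbolic (QF.baseChange M (QF.bin (a i))) := fun i =>
    (Stmt16.isHyp_iff M (a i) (ha i)).2 ⟨s i, hs i⟩
  have hsub : QF.hypSetT (fun i => QF.bin (a i)) ⊆ normSet K M := by
    rintro c ⟨L, hL, hh, hc⟩
    haveI := hL
    exact Stmt16.norm_sub s a hs hgen L.carrier
      (fun i => (Stmt16.isHyp_iff L.carrier (a i) (ha i)).1 (hh i)) hc
  have hsub2 : QF.hypSet2T (fun i => QF.bin (a i)) ⊆ QF.hypSetT (fun i => QF.bin (a i)) := by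
    rintro c ⟨L, hL, hh, hc⟩
    exact ⟨L, hL.1, hh, hc⟩
  have hsup : normSet K M ⊆ QF.hypSet2T (fun i => QF.bin (a i)) := fun c hc =>
    ⟨⟨M⟩, Stmt16.isTwo s a hs hgen hdeg, hMhyp, hc⟩
  have hHyp : (QF.HypT (fun i => QF.bin (a i)) : Set K) = normSet K M := by
    apply Set.Subset.antisymm
    · exact (Submonoid.closure_le (S := Stmt16.normMon K M)).2 hsub
    · exact (hsup.trans hsub2).trans Submonoid.subset_closure
  have hHyp2 : (QF.Hyp2T (fun i => QF.bin (a i)) : Set K) = normSet K M := by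
    apply Set.Subset.antisymm
    · exact (Submonoid.closure_le (S := Stmt16.normMon K M)).2 (hsub2.trans hsub)
    · exact hsup.trans Submonoid.subset_closure
  have hGT : QF.GT (fun i => QF.bin (a i))
        = ⋂ i : Fin r, normSet K (IntermediateField.adjoin K {s i}) := by
    rw [QF.GT]
    exact Set.iInter_congr hG
  refine ⟨hGT, hHyp, hHyp2, ?_, ?_⟩
  · ext x
    simp only [QF.HgrpT, Set.mem_ofPred_eq]
    rw [← hHyp]
    rfl
  · apply Set.Subset.antisymm
    · intro c hc
      simp only [QF.GT, Set.mem_iInter, Stmt16.G_bin] at hc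
      simp only [Set.mem_iInter]
      intro E hE
      obtain ⟨t, b, ht, htb⟩ := Stmt16.exists_sqrt h2 hE
      rw [Stmt16.normSet_quad hE t ht b htb]
      have htb' : (t : M) ^ 2 = algebraMap K M b := congrArg Subtype.val htb
      obtain ⟨T, k, hT⟩ := Stmt16.kummer s a h2 ha hs Finset.univ (t : M) b
        (by rw [Stmt16.F_univ s hgen]; trivial) htb'
      have hTne : T.Nonempty := by
        rw [Finset.nonempty_iff_ne_empty]
        rintro rfl
        exact ht ⟨k, Subtype.ext (by simpa using hT.symm)⟩
      have hk : k ≠ 0 := by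
        rintro rfl
        exact ht ⟨0, Subtype.ext (by simpa using hT.symm)⟩
      have hb : b = k ^ 2 * ∏ i ∈ T, a i := by
        apply (algebraMap K M).injective
        rw [← htb', hT, mul_pow, ← Finset.prod_pow, map_mul, map_pow, map_prod]
        simp only [hs]
      obtain ⟨i, hi⟩ := hTne
      rw [hb]
      exact Stmt16.D_prod h2 T a ha hk (hc i).1 (fun j _ => hc j)
    · rw [hGT]
      intro c hc
      simp only [Set.mem_iInter] at hc ⊢
      exact fun i => hc _ (hfr1 i)
end
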